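/- Assuming the Continuum Hypothesis, there exist 2^𝔠 pairwise non-equivalent Ramseyan ultrafilters, where two partition-ultrafilters U, V are equivalent iff U = f(V) and V = g(U) for some surjections f, g : ω → ω. -/

import Mathlib

open Set

/-- `X` is a partition of ω: pairwise disjoint non-empty subsets covering ℕ. -/
def IsPartition (X : Set (Set ℕ)) : Prop :=
  (∀ b ∈ X, b.Nonempty) ∧ (∀ b ∈ X, ∀ c ∈ X, b ≠ c → Disjoint b c) ∧ ⋃₀ X = Set.univ

/-- `X ⊑ Y` : `X` is coarser than `Y`, i.e. each block of `X` is a union of blocks of `Y`. -/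
def Coarser (X Y : Set (Set ℕ)) : Prop :=
  ∀ b ∈ X, ∃ S ⊆ Y, b = ⋃₀ S

/-- `n` and `m` lie in the same block of `X`. -/
def SameBlock (X : Set (Set ℕ)) (n m : ℕ) : Prop := ∃ b ∈ X, n ∈ b ∧ m ∈ b

/-- The meet `X ⊓ Y` : the finest partition coarser than both `X` and `Y`,
given by the classes of the equivalence relation generated by the two block relations. -/
def pMeet (X Y : Set (Set ℕ)) : Set (Set ℕ) :=
  {b | ∃ n, b = {m | Relation.EqvGen (fun a c => SameBlock X a c ∨ SameBlock Y a c) n m}}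

/-- The one-block partition `{ω}`. -/
def OneBlock : Set (Set ℕ) := {Set.univ}

/-- A partition-filter: a set of partitions of ω not containing `{ω}`,
closed under meets and upward closed under the coarsening relation. -/
def IsPartitionFilter (F : Set (Set (Set ℕ))) : Prop :=
  (∀ X ∈ F, IsPartition X) ∧ OneBlock ∉ F ∧
  (∀ X ∈ F, ∀ Y ∈ F, pMeet X Y ∈ F) ∧
  (∀ X ∈ F, ∀ Y, IsPartition Y → Coarser X Y → Y ∈ F)

/-- A partition-ultrafilter: a maximal partition-filter. -/
def IsPartitionUltrafilter (U : Set (Set (Set ℕ))) : Prop :=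
  IsPartitionFilter U ∧ ∀ F, IsPartitionFilter F → U ⊆ F → U = F

/-- `f(X)` : the finest partition such that `n, m` in a common block of `X`
implies `f n, f m` in a common block of `f(X)`. -/
def imagePart (f : ℕ → ℕ) (X : Set (Set ℕ)) : Set (Set ℕ) :=
  {c | ∃ k, c = {l | Relation.EqvGen
      (fun a b => ∃ n m, SameBlock X n m ∧ f n = a ∧ f m = b) k l}}

/-- `f⁻¹(X) = {f⁻¹(b) : b ∈ X}`. -/
def preimagePart (f : ℕ → ℕ) (X : Set (Set ℕ)) : Set (Set ℕ) :=
  {c | ∃ b ∈ X, c = f ⁻¹' b}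

/-- `f⁻¹(F) = {f⁻¹(X) : X ∈ F}`. -/
def preimageFam (f : ℕ → ℕ) (F : Set (Set (Set ℕ))) : Set (Set (Set ℕ)) :=
  {Y | ∃ X ∈ F, Y = preimagePart f X}

/-- `f(F) = {Y : ∃ X ∈ F, f(X) ⊑ Y}` (among partitions). -/
def imageFilter (f : ℕ → ℕ) (F : Set (Set (Set ℕ))) : Set (Set (Set ℕ)) :=
  {Y | IsPartition Y ∧ ∃ X ∈ F, Coarser (imagePart f X) Y}

/-- A segment: a partition of `{0, …, n-1}`. -/
def IsSegOf (s : Set (Set ℕ)) (n : ℕ) : Prop :=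
  (∀ b ∈ s, b.Nonempty) ∧ (∀ b ∈ s, ∀ c ∈ s, b ≠ c → Disjoint b c) ∧ ⋃₀ s = {k | k < n}

/-- `s*` : the segment `s` (of domain `n`) together with the new block `{n}`. -/
def segExt (s : Set (Set ℕ)) (n : ℕ) : Set (Set ℕ) := insert {n} s

/-- `s ⊴ X` : each block of `s` (a segment of domain `n`) is the trace of a block of `X`. -/
def InitSeg (s : Set (Set ℕ)) (n : ℕ) (X : Set (Set ℕ)) : Prop :=
  ∀ b ∈ s, ∃ d ∈ X, b = d ∩ {k | k < n}

/-- `s ⊑ X` for a segment `s` of domain `n`: each block of `s` is a union of traces of blocks of `X`. -/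
def SegCoarser (s : Set (Set ℕ)) (n : ℕ) (X : Set (Set ℕ)) : Prop :=
  ∀ b ∈ s, ∃ S ⊆ X, b = (⋃₀ S) ∩ {k | k < n}

/-- The segment-coloring-property of a family `C` of (infinite) partitions. -/
def SegColProp (C : Set (Set (Set ℕ))) : Prop :=
  ∀ (k r : ℕ) (π : Set (Set ℕ) → ℕ → Fin (r + 1)), ∀ Z ∈ C,
    ∃ X ∈ C, Coarser X Z ∧
      ∀ (n : ℕ) (s : Set (Set ℕ)) (ns : ℕ),
        IsSegOf s ns → s.ncard = n + 1 → InitSeg s ns X →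
        ∃ c : Fin (r + 1),
          ∀ (u : Set (Set ℕ)) (nu : ℕ),
            IsSegOf u nu → u.ncard = n + k + 1 →
            InitSeg s ns u → SegCoarser (segExt u nu) (nu + 1) X →
            π u nu = c

/-- A Ramseyan ultrafilter: a partition-ultrafilter consisting of infinite partitions
which has the segment-coloring-property. -/
def RamseyanUltrafilter (U : Set (Set (Set ℕ))) : Prop :=
  IsPartitionUltrafilter U ∧ (∀ X ∈ U, X.Infinite) ∧ SegColProp U

/-- `X ⊓ {n}` : glue together all blocks of `X` meeting `{0, …, n-1}` into one block. -/
def glue (X : Set (Set ℕ)) (n : ℕ) : Set (Set ℕ) :=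
  insert (⋃₀ {d ∈ X | ∃ k < n, k ∈ d}) {d ∈ X | ∀ k < n, k ∉ d}

/-- `X ⊑* Y` iff `(X ⊓ {n}) ⊑ Y` for some `n`. -/
def CoarserStar (X Y : Set (Set ℕ)) : Prop := ∃ n, Coarser (glue X n) Y

/-- Meet of a nonempty list of partitions. -/
def listMeet : List (Set (Set ℕ)) → Set (Set ℕ)
  | [] => OneBlock
  | [X] => X
  | X :: Y :: L => pMeet X (listMeet (Y :: L))

/-- The partition-filter generated by a family `B` of partitions:
all partitions `X` such that some finite meet of members of `B` is `⊑*`-below `X`. -/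
def genFilter (B : Set (Set (Set ℕ))) : Set (Set (Set ℕ)) :=
  {X | IsPartition X ∧
    ∃ L : List (Set (Set ℕ)), L ≠ [] ∧ (∀ Y ∈ L, Y ∈ B) ∧ CoarserStar (listMeet L) X}

/-- `X` diagonalizes the family `{X_s : s a segment}` (given as `Xs s n` for `s` of domain `n`). -/
def Diagonalizes (X : Set (Set ℕ)) (Xs : Set (Set ℕ) → ℕ → Set (Set ℕ)) : Prop :=
  Coarser X (Xs ∅ 0) ∧
  ∀ s n, IsSegOf s n → InitSeg (segExt s n) (n + 1) X →
    Coarser (glue X n) (Xs s n)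

/-- The family `A` is relatively happy. -/
def RelativelyHappy (A : Set (Set (Set ℕ))) : Prop :=
  ∀ Xs : Set (Set ℕ) → ℕ → Set (Set ℕ),
    (∀ s n, IsSegOf s n → Xs s n ∈ A) →
    genFilter {X | ∃ s n, IsSegOf s n ∧ X = Xs s n} ⊆ A →
    ∃ X ∈ A, Diagonalizes X Xs

/-- Equivalence of partition-ultrafilters: `U = f(V)` and `V = g(U)` for surjections. -/
def EquivPF (U V : Set (Set (Set ℕ))) : Prop :=
  (∃ f : ℕ → ℕ, Function.Surjective f ∧ imageFilter f V = U) ∧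
  (∃ g : ℕ → ℕ, Function.Surjective g ∧ imageFilter g U = V)

section CS

/-- variable words: constant prefix, then the variable, then a rest. -/
abbrev VWord (A : Type) := List A × List (Option A)

def vev {A : Type} (t : VWord A) (a : A) : FreeMonoid A :=
  FreeMonoid.ofList (t.1 ++ a :: t.2.map (fun o => o.getD a))

def vpre {A : Type} (t : VWord A) : FreeMonoid A := FreeMonoid.ofList t.1

def HasLine {A : Type} (C : Set (FreeMonoid A)) : Prop := ∃ t : VWord A, ∀ a, vev t a ∈ C

theorem split_none {A : Type} (L : List (Option A)) (h : none ∈ L) :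
    ∃ (V : List A) (R : List (Option A)), L = V.map some ++ none :: R := by
  induction L with
  | nil => simp at h
  | cons x L ih =>
    cases x with
    | none => exact ⟨[], L, rfl⟩
    | some a =>
      have : none ∈ L := by simpa using h
      obtain ⟨V, R, rfl⟩ := ih this
      exact ⟨a :: V, R, rfl⟩

theorem hj_words {A : Type} [Finite A] {κ : Type} [Finite κ] (χ : FreeMonoid A → κ) :
    ∃ (t : VWord A) (c : κ), ∀ a, χ (vev t a) = c := by
  obtain ⟨ι, hι, H⟩ := Combinatorics.Line.exists_mono_in_high_dimension A κ
  obtain ⟨n, ⟨e⟩⟩ := Finite.exists_equiv_fin ι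
  obtain ⟨l, c, hl⟩ := H (fun x => χ (FreeMonoid.ofList (List.ofFn (fun i => x (e.symm i)))))
  obtain ⟨i, hi⟩ := l.proper
  obtain ⟨V, R, hVR⟩ := split_none (List.ofFn (fun i => l.idxFun (e.symm i)))
    (by rw [List.mem_ofFn]; exact ⟨e i, by simp [hi]⟩)
  refine ⟨(V, R), c, fun a => ?_⟩
  rw [← hl a]
  congr 1
  unfold vev
  congr 1
  have : List.ofFn (fun i => l a (e.symm i))
      = (List.ofFn (fun i => l.idxFun (e.symm i))).map (fun o => o.getD a) := by
    rw [List.map_ofFn]; rfl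
  rw [this, hVR]
  simp [Function.comp_def]

attribute [local instance] Ultrafilter.mul Ultrafilter.semigroup

theorem exists_line_idem (A : Type) [Finite A] :
    ∃ p : Ultrafilter (FreeMonoid A), p * p = p ∧ ∀ C ∈ p, HasLine C := by
  let H : Set (Ultrafilter (FreeMonoid A)) := {p | ∀ C ∈ p, HasLine C}
  have hne : H.Nonempty := by
    have : (Filter.generate {D : Set (FreeMonoid A) | ¬ HasLine Dᶜ}).NeBot := by
      rw [Filter.generate_neBot_iff]
      intro t ht hfin
      by_contra hemp
      rw [Set.not_nonempty_iff_eq_empty] at hemp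
      have h1 : ∀ w : FreeMonoid A, ∃ D : t, w ∉ D.1 := by
        intro w
        by_contra hcon
        push Not at hcon
        have : w ∈ ⋂₀ t := fun D hD => hcon ⟨D, hD⟩
        rw [hemp] at this
        exact this
      choose χ hχ using h1
      have := hfin.to_subtype
      obtain ⟨t', c, hc⟩ := hj_words χ
      exact ht c.2 ⟨t', fun a => by rw [← hc a]; exact hχ _⟩
    refine ⟨Ultrafilter.of (Filter.generate {D : Set (FreeMonoid A) | ¬ HasLine Dᶜ}), fun C hC => ?_⟩
    by_contra hno
    have : Cᶜ ∈ (Ultrafilter.of (Filter.generate {D : Set (FreeMonoid A) | ¬ HasLine Dᶜ})) :=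
      Ultrafilter.of_le _ (Filter.mem_generate_of_mem (by simpa using hno))
    exact (Ultrafilter.compl_mem_iff_notMem.1 this) hC
  have hcl : IsClosed H := by
    have : H = ⋂ C ∈ {C : Set (FreeMonoid A) | ¬ HasLine C}, {p | Cᶜ ∈ p} := by
      ext p
      simp only [H, Set.mem_ofPred_eq, Set.mem_iInter, Ultrafilter.compl_mem_iff_notMem]
      exact ⟨fun h C hC hp => hC (h C hp), fun h C hp => by_contra fun hC => h C hC hp⟩
    rw [this]
    exact isClosed_biInter fun C _ => ultrafilter_isClosed_basic _
  have hmul : ∀ x ∈ H, ∀ y ∈ H, x * y ∈ H := by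
    intro x hx y hy C hC
    have h1 : ∀ᶠ w in (x : Filter (FreeMonoid A)), ∀ᶠ w' in (y : Filter (FreeMonoid A)),
      w * w' ∈ C := (Ultrafilter.eventually_mul x y (· ∈ C)).1 hC
    obtain ⟨w, hw⟩ := h1.exists
    obtain ⟨t, ht⟩ := hy _ hw
    refine ⟨(w.toList ++ t.1, t.2), fun a => ?_⟩
    have := ht a
    simp only [vev, Set.mem_ofPred_eq] at this ⊢
    convert this using 1
    apply FreeMonoid.toList.injective
    simp
  obtain ⟨m, hm, hmm⟩ := exists_idempotent_in_compact_subsemigroup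
    (fun r => Ultrafilter.continuous_mul_left r) H hne hcl.isCompact hmul
  exact ⟨m, hmm, hm⟩

/-- The ultrafilter heart of the Carlson-Simpson theorem. -/
theorem cs_core (A : Type) [Finite A] {κ : Type} [Finite κ] (χ : List A → κ) :
    ∃ (c : κ) (Good : Set (List A)), Good.Nonempty ∧
      ∀ F : Set (List A), F.Finite → F ⊆ Good → ∃ t : VWord A,
        ∀ f ∈ F, χ (f ++ t.1) = c ∧ ∀ a, f ++ (t.1 ++ a :: t.2.map (fun o => o.getD a)) ∈ Good := by
  obtain ⟨p, hpp, hp⟩ := exists_line_idem A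
  let D : Set (FreeMonoid A) → Set (VWord A) := fun C => {t | ∀ a, vev t a ∈ C}
  have hD : Monotone D := fun C C' h t ht a => h (ht a)
  have hnb : ((p : Filter (FreeMonoid A)).lift' D).NeBot :=
    (Filter.lift'_neBot_iff hD).2 fun C hC => hp C hC
  let q : Ultrafilter (VWord A) := Ultrafilter.of ((p : Filter (FreeMonoid A)).lift' D)
  have hq : ∀ C ∈ p, ∀ᶠ t in (q : Filter (VWord A)), ∀ a, vev t a ∈ C := fun C hC =>
    Ultrafilter.of_le _ ((Filter.mem_lift'_sets hD).2 ⟨C, hC, subset_rfl⟩)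
  let ρ : Ultrafilter (FreeMonoid A) := q.map vpre
  let χ' : FreeMonoid A → κ := fun w => χ w.toList
  obtain ⟨c, hc⟩ := Ultrafilter.eq_pure_of_finite ((p * ρ).map χ')
  have hc1 : ∀ᶠ w in ((p * ρ : Ultrafilter (FreeMonoid A)) : Filter (FreeMonoid A)), χ' w = c := by
    have : ({c} : Set κ) ∈ (p * ρ).map χ' := by rw [hc]; simp
    exact this
  have hc2 := (Ultrafilter.eventually_mul p ρ (fun w => χ' w = c)).1 hc1
  have hc3 : ∀ᶠ w in (p : Filter (FreeMonoid A)), ∀ᶠ w' in (p : Filter (FreeMonoid A)),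
      ∀ᶠ z in (ρ : Filter (FreeMonoid A)), χ' (w * w' * z) = c := by
    have h := hc2
    rw [← hpp] at h
    exact (Ultrafilter.eventually_mul p p (fun w => ∀ᶠ z in (ρ : Filter (FreeMonoid A)), χ' (w * z) = c)).1 h
  let G : Set (FreeMonoid A) := {w | (∀ᶠ z in (ρ : Filter (FreeMonoid A)), χ' (w * z) = c) ∧
    (∀ᶠ w' in (p : Filter (FreeMonoid A)),
      ∀ᶠ z in (ρ : Filter (FreeMonoid A)), χ' (w * w' * z) = c)}
  have hG : ∀ᶠ w in (p : Filter (FreeMonoid A)), w ∈ G := hc2.and hc3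
  have hG2 : ∀ w ∈ G, ∀ᶠ w' in (p : Filter (FreeMonoid A)), w * w' ∈ G := by
    intro w hw
    refine hw.2.and ?_
    have h := hw.2
    rw [← hpp] at h
    have h2 := (Ultrafilter.eventually_mul p p (fun w' => ∀ᶠ z in (ρ : Filter (FreeMonoid A)), χ' (w * w' * z) = c)).1 h
    simpa only [mul_assoc] using h2
  refine ⟨c, FreeMonoid.ofList ⁻¹' G, ?_, ?_⟩
  · obtain ⟨w, hw⟩ := hG.exists
    exact ⟨w.toList, hw⟩
  · intro F hF hFG
    have : ∀ᶠ t in (q : Filter (VWord A)), ∀ f ∈ F, χ (f ++ t.1) = c ∧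
        ∀ a, f ++ (t.1 ++ a :: t.2.map (fun o => o.getD a)) ∈ FreeMonoid.ofList ⁻¹' G := by
      rw [Filter.eventually_all_finite hF]
      intro f hf
      refine Filter.Eventually.and ?_ ?_
      · have h1 : ∀ᶠ z in (ρ : Filter (FreeMonoid A)), χ' (FreeMonoid.ofList f * z) = c := (hFG hf).1
        exact h1
      · exact hq _ (hG2 _ (hFG hf))
    exact this.exists

end CS

theorem cs_inf (j : ℕ) {κ : Type} [Finite κ] (χ : List (Fin (j + 1)) → κ) :
    ∃ (g : ℕ → ℕ) (c : κ), (∀ i ≤ j, g i = i) ∧ ∀ M, j < M → ∃ q, g q = M ∧ (∀ i < q, g i < M) ∧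
      ∀ h : ℕ → Fin (j + 1), (∀ i : Fin (j + 1), h i = i) →
        χ ((List.range q).map (fun x => h (g x))) = c := by
  obtain ⟨c, Good, ⟨w0, hw0⟩, hstep⟩ := cs_core (Fin (j + 1)) (fun w => χ (List.finRange (j + 1) ++ w))
  let Fix : Set (ℕ → Fin (j + 1)) := {h | ∀ i : Fin (j + 1), h i = i}
  let Inv : ℕ → List ℕ → Prop := fun m P => (∀ x ∈ P, x < j + 1 + m) ∧ ∀ h ∈ Fix, P.map h ∈ Good
  have step : ∀ m P, ∃ V R : List ℕ, Inv m P → Inv (m + 1) (P ++ (V ++ (j + 1 + m) :: R)) ∧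
      (∀ x ∈ V, x < j + 1) ∧ ∀ h ∈ Fix, χ (List.finRange (j + 1) ++ (P ++ V).map h) = c := by
    intro m P
    by_cases hI : Inv m P
    swap
    · exact ⟨[], [], fun h => absurd h hI⟩
    obtain ⟨t, ht⟩ := hstep {l | ∃ h ∈ Fix, l = P.map h}
      ((List.finite_length_eq (Fin (j + 1)) P.length).subset (by
        rintro l ⟨h, _, rfl⟩; simp)) (by
        rintro l ⟨h, hh, rfl⟩; exact hI.2 h hh)
    have hV : ∀ h ∈ Fix, (t.1.map Fin.val).map h = t.1 := by
      intro h hh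
      rw [List.map_map]
      conv_rhs => rw [← List.map_id t.1]
      exact List.map_congr_left fun x _ => hh x
    have hR : ∀ h ∈ Fix, (t.2.map (fun o => o.elim (j + 1 + m) Fin.val)).map h
        = t.2.map (fun o => o.getD (h (j + 1 + m))) := by
      intro h hh
      rw [List.map_map]
      refine List.map_congr_left fun x _ => ?_
      cases x with
      | none => rfl
      | some a => exact hh a
    refine ⟨t.1.map Fin.val, t.2.map (fun o => o.elim (j + 1 + m) Fin.val), fun _ => ⟨⟨?_, ?_⟩, ?_, ?_⟩⟩
    · intro x hx
      simp only [List.mem_append, List.mem_cons, List.mem_map] at hx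
      rcases hx with hx | ⟨a, _, rfl⟩ | rfl | ⟨o, _, rfl⟩
      · have := hI.1 x hx; omega
      · have := a.2; omega
      · omega
      · cases o with
        | none => simp
        | some a => have := a.2; simp only [Option.elim]; omega
    · intro h hh
      have := (ht _ ⟨h, hh, rfl⟩).2 (h (j + 1 + m))
      rw [List.map_append, List.map_append, List.map_cons, hV h hh, hR h hh]
      exact this
    · intro x hx
      simp only [List.mem_map] at hx
      obtain ⟨a, _, rfl⟩ := hx
      exact a.2
    · intro h hh
      rw [List.map_append, hV h hh]
      exact (ht _ ⟨h, hh, rfl⟩).1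
  choose V R hVR using step
  let P : ℕ → List ℕ := fun m => Nat.rec (w0.map Fin.val) (fun m P => P ++ (V m P ++ (j + 1 + m) :: R m P)) m
  have hP : ∀ m, P (m + 1) = P m ++ (V m (P m) ++ (j + 1 + m) :: R m (P m)) := fun m => rfl
  have hInv : ∀ m, Inv m (P m) := by
    intro m
    induction m with
    | zero =>
      refine ⟨?_, ?_⟩
      · intro x hx
        obtain ⟨a, _, rfl⟩ := List.mem_map.1 (show x ∈ w0.map Fin.val from hx)
        have := a.2; omega
      · intro h hh
        have : (w0.map Fin.val).map h = w0 := by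
          rw [List.map_map]
          conv_rhs => rw [← List.map_id w0]
          exact List.map_congr_left fun x _ => hh x
        change (w0.map Fin.val).map h ∈ Good
        rw [this]; exact hw0
    | succ m ih => rw [hP]; exact (hVR m _ ih).1
  let full : ℕ → List ℕ := fun m => List.range (j + 1) ++ P m
  have hfull : ∀ m, full (m + 1)
      = (List.range (j + 1) ++ (P m ++ V m (P m))) ++ (j + 1 + m) :: R m (P m) := by
    intro m
    simp only [full, hP, List.append_assoc]
  have hfs : ∀ m, full m <+: full (m + 1) := by
    intro m
    rw [hfull]
    simp only [full]
    exact ⟨V m (P m) ++ (j + 1 + m) :: R m (P m), by simp⟩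
  have hmono : ∀ m m', m ≤ m' → full m <+: full m' := by
    intro m m' h
    induction h with
    | refl => exact List.prefix_refl _
    | step _ ih => exact ih.trans (hfs _)
  have hlen : ∀ m, j + 1 + m ≤ (full m).length := by
    intro m
    induction m with
    | zero => simp [full]
    | succ m ih =>
      rw [hfull]
      simp only [full, List.length_append, List.length_cons, List.length_range] at ih ⊢
      omega
  let g : ℕ → ℕ := fun x => (full x).getD x 0
  have hg : ∀ m x (hx : x < (full m).length), g x = (full m)[x] := by
    intro m x hx
    have hx' : x < (full x).length := by have := hlen x; omega
    have e1 : g x = (full x)[x] := by simp [g, hx']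
    rw [e1]
    rcases le_total m x with h | h
    · exact ((hmono _ _ h).getElem hx).symm
    · exact (hmono _ _ h).getElem hx'
  refine ⟨g, c, ?_, ?_⟩
  · intro i hi
    have : i < (full 0).length := by have := hlen 0; omega
    rw [hg 0 i this]
    simp only [full]
    rw [List.getElem_append_left (by simp; omega)]
    simp
  · intro M hM
    obtain ⟨m, rfl⟩ : ∃ m, M = j + 1 + m := ⟨M - (j + 1), by omega⟩
    set L := List.range (j + 1) ++ (P m ++ V m (P m)) with hL
    have hf := hfull m
    rw [← hL] at hf
    have hgL : ∀ i (hi : i < L.length), g i = L[i] := by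
      intro i hi
      have h1 : i < (full (m + 1)).length := by rw [hf]; simp; omega
      rw [hg (m + 1) i h1]
      simp only [hf]
      exact List.getElem_append_left hi
    refine ⟨L.length, ?_, ?_, ?_⟩
    · have h1 : L.length < (full (m + 1)).length := by rw [hf]; simp
      rw [hg (m + 1) _ h1]
      simp only [hf]
      simp
    · intro i hi
      rw [hgL i hi]
      have hmem : L[i] ∈ L := List.getElem_mem hi
      generalize L[i] = x at hmem
      rw [hL] at hmem
      simp only [List.mem_append, List.mem_range] at hmem
      rcases hmem with h | h | h
      · omega
      · exact (hInv m).1 _ h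
      · have := (hVR m _ (hInv m)).2.1 _ h; omega
    · intro h hh
      have : (List.range L.length).map (fun x => h (g x)) = L.map h := by
        apply List.ext_getElem
        · simp
        · intro i h1 h2
          simp only [List.getElem_map, List.getElem_range]
          rw [hgL]
      rw [this, hL, List.map_append]
      have h2 : (List.range (j + 1)).map h = List.finRange (j + 1) := by
        apply List.ext_getElem
        · simp
        · intro i h1 h2
          simp only [List.getElem_map, List.getElem_range, List.getElem_finRange]
          simp only [List.length_map, List.length_range] at h1
          exact hh ⟨i, h1⟩
      rw [h2]
      exact (hVR m _ (hInv m)).2.2 h hh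

/-- rigid surjections: codes of infinite partitions. -/
def Rig (h : ℕ → ℕ) : Prop := (∀ i, ∀ v < h i, ∃ k < i, h k = v) ∧ Function.Surjective h

def Agree (n : ℕ) (h h' : ℕ → ℕ) : Prop :=
  ∃ m, h m = n ∧ h' m = n ∧ ∀ i < m, h i = h' i ∧ h i < n

def LocalCol {κ : Type} (c : (ℕ → ℕ) → ℕ → κ) : Prop :=
  ∀ n h h', Rig h → Rig h' → Agree n h h' → c h n = c h' n

theorem Rig.comp {h g : ℕ → ℕ} (hh : Rig h) (hg : Rig g) : Rig (h ∘ g) := by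
  refine ⟨?_, hh.2.comp hg.2⟩
  intro i v hv
  obtain ⟨k, hk, rfl⟩ := hh.1 _ v hv
  obtain ⟨l, hl, rfl⟩ := hg.1 _ k hk
  exact ⟨l, hl, rfl⟩

theorem rig_id : Rig id := ⟨fun i v hv => ⟨v, hv, rfl⟩, Function.surjective_id⟩

theorem Rig.le {h : ℕ → ℕ} (hh : Rig h) (i : ℕ) : h i ≤ i := by
  induction i using Nat.strong_induction_on with
  | _ i ih =>
    rcases Nat.eq_zero_or_pos (h i) with h0 | h0
    · omega
    · obtain ⟨k, hk, e⟩ := hh.1 i (h i - 1) (by omega)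
      have := ih k hk
      omega

theorem Rig.first {h : ℕ → ℕ} (hh : Rig h) (n : ℕ) : ∃ m, h m = n ∧ ∀ i < m, h i < n := by
  classical
  have hex := hh.2 n
  refine ⟨Nat.find hex, Nat.find_spec hex, fun i hi => ?_⟩
  by_contra hcon
  rcases Nat.eq_or_lt_of_not_lt hcon with e | e
  · exact Nat.find_min hex hi e
  · obtain ⟨k, hk, e⟩ := hh.1 i n e
    exact Nat.find_min hex (hk.trans hi) e

theorem Agree.comp {n : ℕ} {h h' G : ℕ → ℕ} (hA : Agree n h h') (hG : Rig G) :
    Agree n (h ∘ G) (h' ∘ G) := by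
  obtain ⟨m, h1, h2, h3⟩ := hA
  obtain ⟨q, hq, hq2⟩ := hG.first m
  exact ⟨q, by simp [hq, h1], by simp [hq, h2], fun i hi => h3 _ (hq2 i hi)⟩

theorem one_step (j : ℕ) {κ : Type} [Finite κ] (c : (ℕ → ℕ) → κ)
    (hc : ∀ h h', Rig h → Rig h' → Agree (j + 1) h h' → c h = c h') :
    ∃ g, Rig g ∧ (∀ i ≤ j, g i = i) ∧ ∃ col, ∀ h, Rig h → (∀ i ≤ j, h i = i) →
      c (h ∘ g) = col := by
  let hat : List (Fin (j + 1)) → ℕ → ℕ := fun l i =>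
    if hi : i < l.length then (l[i] : ℕ) else i - l.length + j + 1
  obtain ⟨g, col, hg1, hg2⟩ := cs_inf j (fun l => c (hat l))
  have hgr : Rig g := by
    refine ⟨fun i v hv => ?_, fun v => ?_⟩
    · rcases le_or_gt v j with hvj | hvj
      · refine ⟨v, ?_, hg1 v hvj⟩
        by_contra hcon
        have := hg1 i (by omega)
        omega
      · obtain ⟨q, hq, hq2, -⟩ := hg2 v hvj
        refine ⟨q, ?_, hq⟩
        rcases lt_trichotomy q i with h | h | h
        · exact h
        · subst h; omega
        · have := hq2 i h; omega
    · rcases le_or_gt v j with hvj | hvj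
      · exact ⟨v, hg1 v hvj⟩
      · obtain ⟨q, hq, -⟩ := hg2 v hvj
        exact ⟨q, hq⟩
  refine ⟨g, hgr, hg1, col, ?_⟩
  intro h hh hfix
  obtain ⟨M, hM, hM2⟩ := hh.first (j + 1)
  have hjM : j < M := by
    by_contra hcon
    have := hfix M (by omega)
    omega
  obtain ⟨q, hq, hq2, hq3⟩ := hg2 M hjM
  let h' : ℕ → Fin (j + 1) := fun x => Fin.ofNat (j + 1) (h x)
  have hfix' : ∀ i : Fin (j + 1), h' i = i := by
    intro i
    apply Fin.ext
    have h2 := i.2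
    simp only [h', Fin.ofNat, hfix i (by omega)]
    exact Nat.mod_eq_of_lt h2
  rw [← hq3 h' hfix']
  set l := (List.range q).map (fun x => h' (g x)) with hl
  have hllen : l.length = q := by simp [hl]
  have hH : ∀ i < q, (h ∘ g) i < j + 1 := fun i hi => hM2 _ (hq2 i hi)
  have hHq : (h ∘ g) q = j + 1 := by simp [hq, hM]
  have hhat1 : ∀ i < q, hat l i = (h ∘ g) i := by
    intro i hi
    have : i < l.length := by omega
    simp only [hat, this, dite_true]
    simp only [hl, List.getElem_map, List.getElem_range, h', Fin.ofNat]
    exact Nat.mod_eq_of_lt (hH i hi)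
  have hhat2 : ∀ i, q ≤ i → hat l i = i - q + j + 1 := by
    intro i hi
    have : ¬ i < l.length := by omega
    simp only [hat, this, dite_false]
    rw [hllen]
  have hHr := hh.comp hgr
  have hhatr : Rig (hat l) := by
    have key : ∀ v ≤ j, ∃ k < q, hat l k = v := by
      intro v hv
      obtain ⟨k, hk, e⟩ := hHr.1 q v (by omega)
      exact ⟨k, hk, by rw [hhat1 k hk, e]⟩
    refine ⟨fun i v hv => ?_, fun v => ?_⟩
    · rcases lt_or_ge i q with hi | hi
      · rw [hhat1 i hi] at hv
        obtain ⟨k, hk, e⟩ := hHr.1 i v hv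
        exact ⟨k, hk, by rw [hhat1 k (hk.trans hi), e]⟩
      · rw [hhat2 i hi] at hv
        rcases le_or_gt v j with hvj | hvj
        · obtain ⟨k, hk, e⟩ := key v hvj
          exact ⟨k, by omega, e⟩
        · exact ⟨v - j - 1 + q, by omega, by rw [hhat2 _ (by omega)]; omega⟩
    · rcases le_or_gt v j with hvj | hvj
      · obtain ⟨k, hk, e⟩ := key v hvj
        exact ⟨k, e⟩
      · exact ⟨v - j - 1 + q, by rw [hhat2 _ (by omega)]; omega⟩
  refine hc _ _ hHr hhatr ⟨q, hHq, ?_, ?_⟩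
  · rw [hhat2 q le_rfl]; omega
  · intro i hi
    exact ⟨(hhat1 i hi).symm, hH i hi⟩

theorem Rig.of_comp {H F G : ℕ → ℕ} (hF : Rig F) (hG : Rig G) (e : G = H ∘ F) : Rig H := by
  refine ⟨fun i v hv => ?_, fun v => ?_⟩
  · obtain ⟨y, hy, hy2⟩ := hF.first i
    have : v < G y := by rw [e]; simpa [hy] using hv
    obtain ⟨k, hk, e2⟩ := hG.1 y v this
    exact ⟨F k, hy2 k hk, by rw [← e2, e]; rfl⟩
  · obtain ⟨y, hy⟩ := hG.2 v
    exact ⟨F y, by rw [← hy, e]; rfl⟩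

def extF (j : ℕ) (σ : Fin (j + 1) → Fin (j + 1)) : ℕ → ℕ := fun i =>
  if hi : i < j + 1 then (σ ⟨i, hi⟩ : ℕ) else i - j + σ (Fin.last j)

theorem extF_le {j : ℕ} (σ : Fin (j + 1) → Fin (j + 1)) {i : ℕ} (hi : i < j + 1) :
    extF j σ i = σ ⟨i, hi⟩ := by simp [extF, hi]

theorem extF_gt {j : ℕ} (σ : Fin (j + 1) → Fin (j + 1)) {i : ℕ} (hi : j < i) :
    extF j σ i = i - j + extF j σ j := by
  have : ¬ i < j + 1 := by omega
  rw [extF_le σ (Nat.lt_succ_self j)]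
  simp [extF, this, Fin.last]

def ValidS (j : ℕ) (σ : Fin (j + 1) → Fin (j + 1)) : Prop :=
  Rig (extF j σ) ∧ ∀ i < j, extF j σ i < extF j σ j

/-- the step of the fusion. -/
theorem fusion_step {κ : Type} [Finite κ] (c : (ℕ → ℕ) → ℕ → κ) (hc : LocalCol c) (j : ℕ)
    (G : ℕ → ℕ) (hG : Rig G) :
    ∃ g, Rig g ∧ (∀ i ≤ j, g i = i) ∧ ∀ σ, ValidS j σ → ∃ col, ∀ h, Rig h → (∀ i ≤ j, h i = i) →
      c (extF j σ ∘ h ∘ g ∘ G) (extF j σ j + 1) = col := by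
  classical
  obtain ⟨g, hg1, hg2, col, hcol⟩ := one_step j (κ := (Fin (j + 1) → Fin (j + 1)) → Option κ)
    (fun h σ => if ValidS j σ then some (c (extF j σ ∘ h ∘ G) (extF j σ j + 1)) else none) (by
      intro h h' hh hh' hA
      funext σ
      by_cases hv : ValidS j σ
      · simp only [hv, if_true]
        congr 1
        refine hc _ _ _ (hv.1.comp (hh.comp hG)) (hv.1.comp (hh'.comp hG)) ?_
        obtain ⟨m, h1, h2, h3⟩ := hA
        refine Agree.comp (h := extF j σ ∘ h) (h' := extF j σ ∘ h') ⟨m, ?_, ?_, ?_⟩ hG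
        · simp only [Function.comp, h1]; rw [extF_gt σ (by omega)]; omega
        · simp only [Function.comp, h2]; rw [extF_gt σ (by omega)]; omega
        · intro i hi
          obtain ⟨e1, e2⟩ := h3 i hi
          refine ⟨by simp only [Function.comp, e1], ?_⟩
          simp only [Function.comp]
          rcases Nat.lt_or_ge (h i) j with h4 | h4
          · have := hv.2 _ h4; omega
          · have : h i = j := by omega
            rw [this]; omega
      · simp only [hv, if_false])
  refine ⟨g, hg1, hg2, fun σ hσ => ?_⟩
  refine ⟨c (extF j σ ∘ id ∘ g ∘ G) (extF j σ j + 1), fun h hh hfix => ?_⟩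
  have h1 := congrFun (hcol h hh hfix) σ
  have h2 := congrFun (hcol id rig_id (fun _ _ => rfl)) σ
  rw [← h2] at h1
  simp only [hσ, if_true, Option.some.injEq] at h1
  exact h1

/-- factoring an end extension through a truncation. -/
theorem factor_trunc (j : ℕ) (h1 : ℕ → ℕ) (hh1 : Rig h1) (hlt : ∀ i < j, h1 i < h1 j)
    (σ : Fin (j + 1) → Fin (j + 1)) (hσ : ∀ i (hi : i < j + 1), (σ ⟨i, hi⟩ : ℕ) = h1 i) :
    ValidS j σ ∧ extF j σ j = h1 j ∧
      ∃ h2, Rig h2 ∧ (∀ i ≤ j, h2 i = i) ∧ Agree (h1 j + 1) h1 (extF j σ ∘ h2) := by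
  classical
  have e1 : ∀ i ≤ j, extF j σ i = h1 i := fun i hi => by
    rw [extF_le σ (by omega : i < j + 1), hσ]
  have ej : extF j σ j = h1 j := e1 j le_rfl
  have e2 : ∀ i, j < i → extF j σ i = i - j + h1 j := fun i hi => by rw [extF_gt σ hi, ej]
  have hval : ValidS j σ := by
    refine ⟨⟨fun i v hv => ?_, fun v => ?_⟩, fun i hi => ?_⟩
    · rcases Nat.lt_or_ge j i with hi | hi
      · rw [e2 i hi] at hv
        rcases lt_trichotomy v (h1 j) with h | h | h
        · obtain ⟨k, hk, e⟩ := hh1.1 j v h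
          exact ⟨k, by omega, by rw [e1 k hk.le, e]⟩
        · exact ⟨j, hi, by rw [ej, h]⟩
        · exact ⟨v - h1 j + j, by omega, by rw [e2 _ (by omega)]; omega⟩
      · rw [e1 i hi] at hv
        obtain ⟨k, hk, e⟩ := hh1.1 i v hv
        exact ⟨k, hk, by rw [e1 k (by omega), e]⟩
    · rcases lt_trichotomy v (h1 j) with h | h | h
      · obtain ⟨k, hk, e⟩ := hh1.1 j v h
        exact ⟨k, by rw [e1 k hk.le, e]⟩
      · exact ⟨j, by rw [ej, h]⟩
      · exact ⟨v - h1 j + j, by rw [e2 _ (by omega)]; omega⟩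
    · rw [e1 i hi.le, ej]; exact hlt i hi
  refine ⟨hval, ej, ?_⟩
  obtain ⟨m, hm, hm2⟩ := hh1.first (h1 j + 1)
  have hjm : j < m := by
    by_contra hcon
    rcases Nat.eq_or_lt_of_le (Nat.le_of_not_lt hcon) with h | h
    · rw [h] at hm; omega
    · have := hlt m h; omega
  have hpre : ∀ i, ∃ i0, i < m → i0 ≤ j ∧ h1 i0 = h1 i := by
    intro i
    by_cases hi : i < m
    · have := hm2 i hi
      rcases Nat.eq_or_lt_of_le (Nat.le_of_lt_succ this) with h | h
      · exact ⟨j, fun _ => ⟨le_rfl, h.symm⟩⟩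
      · obtain ⟨k, hk, e⟩ := hh1.1 j _ h
        exact ⟨k, fun _ => ⟨hk.le, e⟩⟩
    · exact ⟨0, fun h => absurd h hi⟩
  choose pre hpre using hpre
  let h2 : ℕ → ℕ := fun i => if i ≤ j then i else if i < m then pre i else i - m + j + 1
  have a1 : ∀ i ≤ j, h2 i = i := fun i hi => by simp [h2, hi]
  have a2 : ∀ i, j < i → i < m → h2 i = pre i := fun i hi hi2 => by
    simp [h2, not_le.2 hi, hi2]
  have a3 : ∀ i, m ≤ i → h2 i = i - m + j + 1 := fun i hi => by
    simp [h2, not_lt.2 hi, not_le.2 (hjm.trans_le hi)]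
  refine ⟨h2, ⟨fun i v hv => ?_, fun v => ?_⟩, a1, m, hm, ?_, ?_⟩
  · rcases Nat.lt_or_ge j i with hi | hi
    · rcases Nat.lt_or_ge i m with him | him
      · rw [a2 i hi him] at hv
        have := (hpre i him).1
        exact ⟨v, by omega, a1 v (by omega)⟩
      · rw [a3 i him] at hv
        rcases Nat.lt_or_ge j v with h | h
        · exact ⟨v - j - 1 + m, by omega, by rw [a3 _ (by omega)]; omega⟩
        · exact ⟨v, by omega, a1 v h⟩
    · rw [a1 i hi] at hv
      exact ⟨v, hv, a1 v (by omega)⟩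
  · rcases Nat.lt_or_ge j v with h | h
    · exact ⟨v - j - 1 + m, by rw [a3 _ (by omega)]; omega⟩
    · exact ⟨v, a1 v h⟩
  · simp only [Function.comp]
    rw [a3 m le_rfl, e2 _ (by omega)]; omega
  · intro i hi
    refine ⟨?_, hm2 i hi⟩
    simp only [Function.comp]
    rcases Nat.lt_or_ge j i with h | h
    · rw [a2 i h hi, e1 _ (hpre i hi).1, (hpre i hi).2]
    · rw [a1 i h, e1 i h]

theorem fusion {κ : Type} [Finite κ] (c : (ℕ → ℕ) → ℕ → κ) (hc : LocalCol c) :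
    ∃ G, Rig G ∧ LocalCol (fun h n => c (h ∘ G) (n + 1)) := by
  have hex : ∀ (j : ℕ) (G : ℕ → ℕ), ∃ g, Rig G → (Rig g ∧ (∀ i ≤ j, g i = i) ∧
      ∀ σ, ValidS j σ → ∃ col, ∀ h, Rig h → (∀ i ≤ j, h i = i) →
      c (extF j σ ∘ h ∘ g ∘ G) (extF j σ j + 1) = col) := by
    intro j G
    by_cases hG : Rig G
    · obtain ⟨g, hg⟩ := fusion_step c hc j G hG
      exact ⟨g, fun _ => hg⟩
    · exact ⟨id, fun h => absurd h hG⟩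
  choose st hst using hex
  let Gs : ℕ → ℕ → ℕ := fun j => Nat.rec id (fun j G => st j G ∘ G) j
  have hGs : ∀ j, Gs (j + 1) = st j (Gs j) ∘ Gs j := fun j => rfl
  have hR : ∀ j, Rig (Gs j) := by
    intro j
    induction j with
    | zero => exact rig_id
    | succ j ih => rw [hGs]; exact (hst j _ ih).1.comp ih
  have hstab : ∀ j j', j ≤ j' → ∀ y, Gs j y ≤ j → Gs j' y = Gs j y := by
    intro j j' hjj y hy
    induction hjj with
    | refl => rfl
    | @step k hk ih =>
      rw [← ih, hGs]
      have hk' : j ≤ k := hk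
      exact (hst k _ (hR k)).2.1 _ (by omega)
  have hcoh : ∀ j j', j ≤ j' → ∀ x y, Gs j x = Gs j y → Gs j' x = Gs j' y := by
    intro j j' hjj x y hxy
    induction hjj with
    | refl => exact hxy
    | step _ ih => rw [hGs]; simp only [Function.comp, ih]
  let G : ℕ → ℕ := fun x => Gs x x
  have hGx : ∀ j x, x ≤ j → G x = Gs j x := fun j x hx =>
    (hstab x j hx x ((hR x).le x)).symm
  have hGy : ∀ j y, Gs j y ≤ j → G y = Gs j y := by
    intro j y hy
    rw [hGx (max j y) y (le_max_right _ _), hstab j _ (le_max_left _ _) y hy]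
  have hGR : Rig G := by
    refine ⟨fun i v hv => ?_, fun v => ?_⟩
    · obtain ⟨k, hk, e⟩ := (hR i).1 i v hv
      exact ⟨k, hk, by rw [hGx i k hk.le, e]⟩
    · obtain ⟨y, hy⟩ := (hR v).2 v
      exact ⟨y, by rw [hGy v y hy.le, hy]⟩
  have hfac : ∀ j, ∃ H, Rig H ∧ (∀ i ≤ j, H i = i) ∧ G = H ∘ Gs j := by
    intro j
    choose m hm using (hR j).2
    have e : G = (fun i => G (m i)) ∘ Gs j := by
      funext x
      simp only [Function.comp]
      have h1 := hcoh j (max j (max x (m (Gs j x)))) (le_max_left _ _) x (m (Gs j x)) (hm _).symm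
      rw [hGx (max j (max x (m (Gs j x)))) x (by simp),
        hGx (max j (max x (m (Gs j x)))) (m (Gs j x)) (by simp)]
      exact h1
    refine ⟨fun i => G (m i), Rig.of_comp (hR j) hGR e, fun i hi => ?_, e⟩
    change G (m i) = i
    rw [hGy j _ (by rw [hm]; exact hi), hm]
  refine ⟨G, hGR, ?_⟩
  intro n h h' hh hh' ⟨j, hj1, hj2, hj3⟩
  obtain ⟨H, hH, hHfix, hHG⟩ := hfac (j + 1)
  have hnj : n ≤ j := by rw [← hj1]; exact hh.le j
  let σ : Fin (j + 1) → Fin (j + 1) := fun i => Fin.ofNat (j + 1) (h i)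
  have hle : ∀ i < j + 1, h i = h' i ∧ h i ≤ n := by
    intro i hi
    rcases Nat.eq_or_lt_of_le (Nat.le_of_lt_succ hi) with e | e
    · rw [e, hj1, hj2]; exact ⟨rfl, le_rfl⟩
    · exact ⟨(hj3 i e).1, (hj3 i e).2.le⟩
  have hσ : ∀ i (hi : i < j + 1), (σ ⟨i, hi⟩ : ℕ) = h i := by
    intro i hi
    simp only [σ, Fin.ofNat]
    have := (hle i hi).2
    exact Nat.mod_eq_of_lt (by omega)
  have main : ∀ k, Rig k → (∀ i < j + 1, k i = h i) →
      ∃ h2, Rig h2 ∧ (∀ i ≤ j, h2 i = i) ∧ ValidS j σ ∧ extF j σ j = n ∧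
      c (k ∘ G) (n + 1) = c (extF j σ ∘ h2 ∘ st j (Gs j) ∘ Gs j) (n + 1) := by
    intro k hk hkh
    have hkH : ∀ i < j + 1, (k ∘ H) i = h i := by
      intro i hi
      simp only [Function.comp]
      rw [hHfix i (by omega), hkh i hi]
    obtain ⟨hv, ej, h2, hh2, hfix2, hA⟩ := factor_trunc j (k ∘ H) (hk.comp hH) (by
      intro i hi
      rw [hkH i (by omega), hkH j (by omega), hj1]
      exact (hj3 i hi).2) σ (by
      intro i hi
      rw [hkH i hi, hσ])
    rw [hkH j (by omega), hj1] at hA ej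
    refine ⟨h2, hh2, hfix2, hv, ej, ?_⟩
    have := hc _ _ _ ((hk.comp hH).comp (hR (j + 1))) ((hv.1.comp hh2).comp (hR (j + 1)))
      (hA.comp (hR (j + 1)))
    rw [hHG]
    exact this
  obtain ⟨h2, hh2, hf2, hv, ej, E⟩ := main h hh (fun _ _ => rfl)
  obtain ⟨h2', hh2', hf2', -, -, E'⟩ := main h' hh' (fun i hi => (hle i hi).1.symm)
  obtain ⟨col, hcol⟩ := (hst j _ (hR j)).2.2 σ hv
  rw [ej] at hcol
  change c (h ∘ G) (n + 1) = c (h' ∘ G) (n + 1)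
  rw [E, E', hcol h2 hh2 hf2, hcol h2' hh2' hf2']

/-- homogeneity of a rigid surjection for a colouring -/
def HomF {κ : Type} (c : (ℕ → ℕ) → ℕ → κ) (k : ℕ) (G : ℕ → ℕ) : Prop :=
  ∀ n h, Rig h → (∀ i ≤ n, h i = i) → c (h ∘ G) (n + k + 1) = c G (n + k + 1)

theorem dual_ramsey {κ : Type} [Finite κ] (k : ℕ) : ∀ (c : (ℕ → ℕ) → ℕ → κ), LocalCol c →
    ∃ G, Rig G ∧ HomF c k G := by
  induction k with
  | zero =>
    intro c hc
    obtain ⟨G, hG, hloc⟩ := fusion c hc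
    refine ⟨G, hG, fun n h hh hfix => ?_⟩
    exact hloc n h id hh rig_id ⟨n, hfix n le_rfl, rfl, fun i hi => ⟨hfix i hi.le, by
      rw [hfix i hi.le]; exact hi⟩⟩
  | succ k ih =>
    intro c hc
    obtain ⟨G, hG, hloc⟩ := fusion c hc
    obtain ⟨G', hG', hh'⟩ := ih _ hloc
    refine ⟨G' ∘ G, hG'.comp hG, fun n h hh hfix => ?_⟩
    exact hh' n h hh hfix

theorem dual_ramsey_below {κ : Type} [Finite κ] (k : ℕ) (c : (ℕ → ℕ) → ℕ → κ) (hc : LocalCol c)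
    (f : ℕ → ℕ) (hf : Rig f) : ∃ G, Rig G ∧ HomF c k (G ∘ f) := by
  obtain ⟨G, hG, h⟩ := dual_ramsey k (fun h n => c (h ∘ f) n) (by
    intro n h h' hh hh' hA
    exact hc _ _ _ (hh.comp hf) (hh'.comp hf) (hA.comp hf))
  exact ⟨G, hG, h⟩

theorem rigidify {α : Type*} (w : ℕ → α) (hinf : (Set.range w).Infinite) :
    ∃ f, Rig f ∧ ∀ x y, f x = f y ↔ w x = w y := by
  classical
  have hex : ∀ x, ∃ y, w y = w x := fun x => ⟨x, rfl⟩
  let μ : ℕ → ℕ := fun x => Nat.find (hex x)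
  have hμ : ∀ x, w (μ x) = w x := fun x => Nat.find_spec (hex x)
  have hμle : ∀ x, μ x ≤ x := fun x => Nat.find_min' (hex x) rfl
  have hμe : ∀ x y, w x = w y → μ x = μ y := by
    intro x y h
    apply le_antisymm
    · exact Nat.find_min' (hex x) (by rw [hμ y, h])
    · exact Nat.find_min' (hex y) (by rw [hμ x, h])
  let p : ℕ → Prop := fun y => μ y = y
  have hp : ∀ x, p (μ x) := fun x => hμe _ _ (hμ x)
  have hpinf : {y | p y}.Infinite := by
    intro hfin
    refine hinf ((hfin.image w).subset ?_)
    rintro _ ⟨x, rfl⟩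
    exact ⟨μ x, hp x, hμ x⟩
  refine ⟨fun x => Nat.count p (μ x), ⟨?_, ?_⟩, ?_⟩
  · intro i v hv
    have hv : v < Nat.count p (μ i) := hv
    have h1 : p (Nat.nth p v) := Nat.nth_mem_of_infinite hpinf v
    refine ⟨Nat.nth p v, ?_, ?_⟩
    · have : Nat.nth p v < μ i := by
        by_contra hcon
        have := Nat.count_monotone p (not_lt.1 hcon)
        rw [Nat.count_nth_of_infinite hpinf] at this
        omega
      exact this.trans_le (hμle i)
    · have h2 : μ (Nat.nth p v) = Nat.nth p v := h1
      change Nat.count p (μ (Nat.nth p v)) = v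
      rw [h2, Nat.count_nth_of_infinite hpinf]
  · intro v
    have h1 : μ (Nat.nth p v) = Nat.nth p v := Nat.nth_mem_of_infinite hpinf v
    exact ⟨Nat.nth p v, by
      change Nat.count p (μ (Nat.nth p v)) = v
      rw [h1, Nat.count_nth_of_infinite hpinf]⟩
  · intro x y
    constructor
    · intro h
      have := Nat.count_injective (hp x) (hp y) h
      rw [← hμ x, ← hμ y, this]
    · intro h
      simp only [hμe x y h]

def partOf (f : ℕ → ℕ) : Set (Set ℕ) := {b | ∃ v, b = {x | f x = v}}

theorem sameBlock_partOf (f : ℕ → ℕ) (x y : ℕ) : SameBlock (partOf f) x y ↔ f x = f y := by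
  constructor
  · rintro ⟨b, ⟨v, rfl⟩, h1, h2⟩
    exact Eq.trans h1 (Eq.symm h2)
  · intro h
    exact ⟨{z | f z = f x}, ⟨f x, rfl⟩, rfl, h.symm⟩

theorem isPartition_partOf (f : ℕ → ℕ) (hf : Rig f) : IsPartition (partOf f) := by
  refine ⟨?_, ?_, ?_⟩
  · rintro b ⟨v, rfl⟩
    exact hf.2 v
  · rintro b ⟨v, rfl⟩ c ⟨v', rfl⟩ hne
    rw [Set.disjoint_left]
    intro x hx hx'
    apply hne
    have e1 : f x = v := hx
    have e2 : f x = v' := hx'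
    rw [← e1, ← e2]
  · ext x
    simp only [Set.mem_sUnion, Set.mem_univ, iff_true]
    exact ⟨{z | f z = f x}, ⟨f x, rfl⟩, rfl⟩

theorem seg_lemma (t : Set (Set ℕ)) (N : ℕ) (ht : IsSegOf t N) (F : ℕ → ℕ) (hF : Rig F)
    (hS : ∀ x < N, ∀ y < N, (SameBlock t x y ↔ F x = F y)) :
    (∀ v, v < t.ncard ↔ ∃ x < N, F x = v) ∧
      t = {b | ∃ v < t.ncard, b = {x | x < N ∧ F x = v}} := by
  obtain ⟨hne, hdis, hun⟩ := ht
  have hcov : ∀ x < N, ∃ b ∈ t, x ∈ b := by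
    intro x hx
    have : x ∈ ⋃₀ t := by rw [hun]; exact hx
    exact this
  have hsub : ∀ b ∈ t, ∀ x ∈ b, x < N := by
    intro b hb x hx
    have : x ∈ ⋃₀ t := ⟨b, hb, hx⟩
    rw [hun] at this
    exact this
  have hblk : ∀ b ∈ t, ∀ x ∈ b, b = {y | y < N ∧ F y = F x} := by
    intro b hb x hx
    ext y
    constructor
    · intro hy
      exact ⟨hsub b hb y hy, ((hS y (hsub b hb y hy) x (hsub b hb x hx)).1 ⟨b, hb, hy, hx⟩)⟩
    · rintro ⟨hy, e⟩
      obtain ⟨d, hd, h1, h2⟩ := (hS y hy x (hsub b hb x hx)).2 e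
      have : d = b := by
        by_contra hcon
        exact Set.disjoint_left.1 (hdis d hd b hb hcon) h2 hx
      rw [← this]; exact h1
  let V : Set ℕ := {v | ∃ x < N, F x = v}
  have hVfin : V.Finite := (Set.finite_Iio N).image F |>.subset (by
    rintro v ⟨x, hx, rfl⟩; exact ⟨x, hx, rfl⟩)
  have himg : t = (fun v => {x | x < N ∧ F x = v}) '' V := by
    ext b
    constructor
    · intro hb
      obtain ⟨x, hx⟩ := hne b hb
      exact ⟨F x, ⟨x, hsub b hb x hx, rfl⟩, (hblk b hb x hx).symm⟩
    · rintro ⟨v, ⟨x, hx, rfl⟩, rfl⟩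
      obtain ⟨b, hb, hxb⟩ := hcov x hx
      have := hblk b hb x hxb
      simp only
      rw [← this]; exact hb
  have hcard : t.ncard = V.ncard := by
    conv_lhs => rw [himg]
    apply Set.ncard_image_of_injOn
    rintro v ⟨x, hx, rfl⟩ v' _ e
    have : x ∈ {y | y < N ∧ F y = F x} := ⟨hx, rfl⟩
    simp only at e
    rw [e] at this
    exact this.2
  have hdown : ∀ v ∈ V, ∀ v' < v, v' ∈ V := by
    rintro v ⟨x, hx, rfl⟩ v' hv'
    obtain ⟨y, hy, e⟩ := hF.1 x v' hv'
    exact ⟨y, hy.trans hx, e⟩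
  have hVK : ∃ K, V = Set.Iio K := by
    classical
    have hex : ∃ K, K ∉ V := by
      by_contra hcon
      push Not at hcon
      exact Set.infinite_univ (hVfin.subset (fun x _ => hcon x))
    refine ⟨Nat.find hex, ?_⟩
    ext v
    constructor
    · intro hv
      by_contra hcon
      rcases Nat.eq_or_lt_of_le (not_lt.1 hcon) with e | e
      · exact Nat.find_spec hex (e ▸ hv)
      · exact Nat.find_spec hex (hdown v hv _ e)
    · intro hv
      by_contra hcon
      exact Nat.find_min hex hv hcon
  obtain ⟨K, hK⟩ := hVK
  have hcK : t.ncard = K := by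
    rw [hcard, hK]
    rw [← Finset.coe_Iio, Set.ncard_coe_finset]; simp
  have h1 : ∀ v, v < t.ncard ↔ ∃ x < N, F x = v := by
    intro v
    rw [hcK]
    have : v ∈ V ↔ v ∈ Set.Iio K := by rw [hK]
    exact this.symm
  refine ⟨h1, ?_⟩
  ext b
  constructor
  · intro hb
    rw [himg] at hb
    obtain ⟨v, hv, rfl⟩ := hb
    exact ⟨v, (h1 v).2 hv, rfl⟩
  · rintro ⟨v, hv, rfl⟩
    rw [himg]
    exact ⟨v, (h1 v).1 hv, rfl⟩

noncomputable def wordOf (h : ℕ → ℕ) (n : ℕ) : List ℕ := (List.range (sInf {m | h m = n})).map h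

theorem sInf_first {h : ℕ → ℕ} {m n : ℕ} (hm : h m = n) (hlt : ∀ i < m, h i < n) :
    sInf {m | h m = n} = m := by
  apply le_antisymm
  · exact Nat.sInf_le hm
  · by_contra hcon
    have h1 : sInf {m | h m = n} ∈ {m | h m = n} := Nat.sInf_mem ⟨m, hm⟩
    have h2 := hlt _ (not_le.1 hcon)
    have h3 : h (sInf {m | h m = n}) = n := h1
    omega

theorem wordOf_eq {h : ℕ → ℕ} {m n : ℕ} (hm : h m = n) (hlt : ∀ i < m, h i < n) :
    wordOf h n = (List.range m).map h := by
  rw [wordOf, sInf_first hm hlt]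

theorem local_wordOf {κ : Type} (π : List ℕ → κ) : LocalCol (fun h n => π (wordOf h n)) := by
  intro n h h' _ _ ⟨m, h1, h2, h3⟩
  simp only
  rw [wordOf_eq h1 (fun i hi => (h3 i hi).2),
    wordOf_eq h2 (fun i hi => by rw [← (h3 i hi).1]; exact (h3 i hi).2)]
  congr 1
  apply List.map_congr_left
  intro i hi
  exact (h3 i (List.mem_range.1 hi)).1

def segL (l : List ℕ) : Set (Set ℕ) := {b | ∃ v ∈ l, b = {x | l[x]? = some v}}

theorem seg_translate (k : ℕ) {κ : Type} (π : Set (Set ℕ) → ℕ → κ) (F : ℕ → ℕ) (hF : Rig F)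
    (hom : HomF (fun h n => π (segL (wordOf h n)) (wordOf h n).length) k F) :
    ∀ (n : ℕ) (s : Set (Set ℕ)) (ns : ℕ),
        IsSegOf s ns → s.ncard = n + 1 → InitSeg s ns (partOf F) →
        ∃ c : κ,
          ∀ (u : Set (Set ℕ)) (nu : ℕ),
            IsSegOf u nu → u.ncard = n + k + 1 →
            InitSeg s ns u → SegCoarser (segExt u nu) (nu + 1) (partOf F) →
            π u nu = c := by
  intro n s ns hs hsc hsF
  refine ⟨π (segL (wordOf F (n + k + 1))) (wordOf F (n + k + 1)).length,
    fun u nu hu huc hsu hcoar => ?_⟩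
  have hcovs : ∀ x < ns, ∃ b ∈ s, x ∈ b := by
    intro x hx
    have : x ∈ ⋃₀ s := by rw [hs.2.2]; exact hx
    exact this
  have hcovu : ∀ x < nu, ∃ b ∈ u, x ∈ b := by
    intro x hx
    have : x ∈ ⋃₀ u := by rw [hu.2.2]; exact hx
    exact this
  have hsubu : ∀ b ∈ u, ∀ x ∈ b, x < nu := by
    intro b hb x hx
    have : x ∈ ⋃₀ u := ⟨b, hb, hx⟩
    rw [hu.2.2] at this
    exact this
  have hequ : ∀ b ∈ u, ∀ d ∈ u, ∀ x, x ∈ b → x ∈ d → b = d := by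
    intro b hb d hd x h1 h2
    by_contra hcon
    exact Set.disjoint_left.1 (hu.2.1 b hb d hd hcon) h1 h2
  -- SameBlock s on ns is F-equality
  have hsS : ∀ x < ns, ∀ y < ns, (SameBlock s x y ↔ F x = F y) := by
    intro x hx y hy
    constructor
    · rintro ⟨b, hb, h1, h2⟩
      obtain ⟨d, ⟨v, rfl⟩, rfl⟩ := hsF b hb
      exact Eq.trans h1.1 (Eq.symm h2.1)
    · intro e
      obtain ⟨b, hb, hxb⟩ := hcovs x hx
      obtain ⟨d, ⟨v, rfl⟩, rfl⟩ := hsF b hb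
      exact ⟨_, hb, hxb, ⟨e.symm.trans hxb.1, hy⟩⟩
  have hnsnu : ns ≤ nu := by
    by_contra hcon
    push Not at hcon
    obtain ⟨b, hb, hxb⟩ := hcovs nu hcon
    obtain ⟨d, hd, rfl⟩ := hsu b hb
    exact lt_irrefl _ (hsubu d hd _ hxb.1)
  have hsub2 : ∀ x < ns, ∀ y < ns, SameBlock u x y → F x = F y := by
    intro x hx y hy ⟨b, hb, h1, h2⟩
    rw [← hsS x hx y hy]
    obtain ⟨b', hb', hxb'⟩ := hcovs x hx
    obtain ⟨d, hd, rfl⟩ := hsu b' hb'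
    have : b = d := hequ b hb d hd x h1 hxb'.1
    subst this
    exact ⟨_, hb', hxb', ⟨h2, hy⟩⟩
  -- u is coarser than F
  have huF : ∀ x < nu, ∀ y < nu, F x = F y → SameBlock u x y := by
    intro x hx y hy e
    obtain ⟨b, hb, hxb⟩ := hcovu x hx
    obtain ⟨S, hS, hbS⟩ := hcoar b (Set.mem_insert_of_mem _ hb)
    have hx2 : x ∈ ⋃₀ S := by rw [hbS] at hxb; exact hxb.1
    obtain ⟨d, hd, hxd⟩ := hx2
    obtain ⟨v, rfl⟩ := hS hd
    refine ⟨b, hb, hxb, ?_⟩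
    rw [hbS]
    exact ⟨⟨_, hd, e.symm.trans hxd⟩, Nat.lt_succ_of_lt hy⟩
  have hnu : ∀ x < nu, F x < F nu := by
    have h0 : ∀ x < nu, F x ≠ F nu := by
      intro x hx e
      obtain ⟨S, hS, hbS⟩ := hcoar {nu} (Set.mem_insert _ _)
      have h1 : nu ∈ (⋃₀ S) ∩ {k | k < nu + 1} := by rw [← hbS]; rfl
      obtain ⟨d, hd, hxd⟩ := h1.1
      obtain ⟨v, rfl⟩ := hS hd
      have h2 : x ∈ (⋃₀ S) ∩ {k | k < nu + 1} := ⟨⟨_, hd, e.trans hxd⟩, Nat.lt_succ_of_lt hx⟩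
      rw [← hbS] at h2
      have : x = nu := h2
      omega
    intro x hx
    by_contra hcon
    rcases Nat.eq_or_lt_of_le (not_lt.1 hcon) with e | e
    · exact h0 x hx e.symm
    · obtain ⟨y, hy, e2⟩ := hF.1 x _ e
      exact h0 y (hy.trans hx) e2
  choose m hm hm2 using hF.first
  have hmle : ∀ x, m (F x) ≤ x := by
    intro x
    by_contra hcon
    exact lt_irrefl _ (hm2 (F x) x (not_le.1 hcon))
  have hmN : ∀ i, m i < nu ↔ i < F nu := by
    intro i
    constructor
    · intro h; have := hnu _ h; rwa [hm] at this
    · intro h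
      obtain ⟨y, hy, e⟩ := hF.1 nu i h
      rw [← e]; exact (hmle y).trans_lt hy
  -- label of an index
  classical
  choose! bl hbl1 hbl2 using hcovu
  let lab : ℕ → Set ℕ ⊕ ℕ := fun i => if m i < nu then Sum.inl (bl (m i)) else Sum.inr i
  have hinf : (Set.range lab).Infinite := by
    have hsubr : (fun i => (Sum.inr i : Set ℕ ⊕ ℕ)) '' Set.Ici (F nu) ⊆ Set.range lab := by
      rintro _ ⟨i, hi, rfl⟩
      refine ⟨i, ?_⟩
      have : ¬ m i < nu := by rw [hmN]; exact not_lt.2 hi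
      simp [lab, this]
    refine Set.Infinite.mono hsubr ((Set.Ici_infinite _).image ?_)
    intro a _ b _ e
    exact Sum.inr_injective e
  obtain ⟨h, hh, hlab⟩ := rigidify lab hinf
  have hHS : ∀ x < nu, ∀ y < nu, (SameBlock u x y ↔ (h ∘ F) x = (h ∘ F) y) := by
    intro x hx y hy
    simp only [Function.comp]
    rw [hlab]
    have h1 := (hmle x).trans_lt hx
    have h2 := (hmle y).trans_lt hy
    simp only [lab, h1, h2, if_true, Sum.inl.injEq]
    obtain ⟨b, hb, hb1, hb2⟩ := huF x hx _ h1 (hm (F x)).symm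
    obtain ⟨d, hd, hd1, hd2⟩ := huF y hy _ h2 (hm (F y)).symm
    have e1 : bl (m (F x)) = b := hequ _ (hbl1 _ h1) _ hb _ (hbl2 _ h1) hb2
    have e2 : bl (m (F y)) = d := hequ _ (hbl1 _ h2) _ hd _ (hbl2 _ h2) hd2
    rw [e1, e2]
    constructor
    · rintro ⟨z, hz, hz1, hz2⟩
      rw [hequ b hb z hz x hb1 hz1, hequ d hd z hz y hd1 hz2]
    · intro e
      exact ⟨b, hb, hb1, by rw [e]; exact hd1⟩
  have hHr := hh.comp hF
  obtain ⟨hu1, hu2⟩ := seg_lemma u nu hu (h ∘ F) hHr hHS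
  obtain ⟨hs1, hs2⟩ := seg_lemma s ns hs F hF hsS
  rw [huc] at hu1 hu2
  rw [hsc] at hs1
  -- h fixes the first n+1 letters
  have hfix : ∀ i ≤ n, h i = i := by
    have hinj : ∀ i ≤ n, ∀ i' ≤ n, h i = h i' → i = i' := by
      intro i hi i' hi' e
      obtain ⟨x, hx, rfl⟩ := (hs1 i).1 (by omega)
      obtain ⟨y, hy, rfl⟩ := (hs1 i').1 (by omega)
      exact hsub2 x hx y hy ((hHS x (by omega) y (by omega)).2 e)
    intro i
    induction i using Nat.strong_induction_on with
    | _ i ih =>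
      intro hi
      rcases Nat.eq_or_lt_of_le (hh.le i) with e | e
      · exact e
      · have := ih (h i) e (by omega)
        have := hinj _ (by omega) i hi this
        omega
  have hHnu : (h ∘ F) nu = n + k + 1 := by
    have hnew : ∀ x < nu, (h ∘ F) x ≠ (h ∘ F) nu := by
      intro x hx e
      simp only [Function.comp] at e
      rw [hlab] at e
      have h1 := (hmle x).trans_lt hx
      have h2 : ¬ m (F nu) < nu := by rw [hmN]; exact lt_irrefl _
      simp only [lab, h1, h2, if_true, if_false] at e
      exact absurd e (by simp)
    rcases lt_trichotomy ((h ∘ F) nu) (n + k + 1) with e | e | e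
    · obtain ⟨x, hx, e2⟩ := (hu1 _).1 e
      exact absurd e2 (hnew x hx)
    · exact e
    · obtain ⟨x, hx, e2⟩ := hHr.1 _ _ e
      have := (hu1 _).2 ⟨x, hx, e2⟩
      omega
  have hword : wordOf (h ∘ F) (n + k + 1) = (List.range nu).map (h ∘ F) :=
    wordOf_eq hHnu (fun i hi => (hu1 _).2 ⟨i, hi, rfl⟩)
  have hlen : (wordOf (h ∘ F) (n + k + 1)).length = nu := by rw [hword]; simp
  have hseg : segL (wordOf (h ∘ F) (n + k + 1)) = u := by
    rw [hu2, hword]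
    ext b
    simp only [segL]
    have hset : ∀ v, {x | ((List.range nu).map (h ∘ F))[x]? = some v}
        = {x | x < nu ∧ (h ∘ F) x = v} := by
      intro v
      ext x
      change ((List.range nu).map (h ∘ F))[x]? = some v ↔ x < nu ∧ (h ∘ F) x = v
      rw [List.getElem?_eq_some_iff]
      simp
    constructor
    · rintro ⟨v, hv, rfl⟩
      obtain ⟨x, hx, rfl⟩ := List.mem_map.1 hv
      exact ⟨_, (hu1 _).2 ⟨x, List.mem_range.1 hx, rfl⟩, hset _⟩
    · rintro ⟨v, hv, rfl⟩
      obtain ⟨x, hx, rfl⟩ := (hu1 v).1 hv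
      exact ⟨_, List.mem_map.2 ⟨x, List.mem_range.2 hx, rfl⟩, (hset _).symm⟩
  have := hom n h hh hfix
  simp only at this
  rw [hseg, hlen] at this
  exact this

def Le (f g : ℕ → ℕ) : Prop := ∀ x y, g x = g y → f x = f y

def glueF (n : ℕ) (f : ℕ → ℕ) : ℕ → ℕ := fun x => f x - n

def LeStar (f g : ℕ → ℕ) : Prop := ∃ n, Le (glueF n f) g

theorem Le.rfl' (f : ℕ → ℕ) : Le f f := fun _ _ h => h

theorem Le.tr {f g h : ℕ → ℕ} (h1 : Le f g) (h2 : Le g h) : Le f h :=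
  fun x y e => h1 x y (h2 x y e)

theorem rig_glueF (n : ℕ) {f : ℕ → ℕ} (hf : Rig f) : Rig (glueF n f) := by
  have h : Rig (fun i => i - n) := by
    refine ⟨fun i v hv => ⟨v + n, ?_, ?_⟩, fun v => ⟨v + n, ?_⟩⟩
    · simp only at hv; omega
    · simp
    · simp
  exact h.comp hf

theorem glueF_le (n : ℕ) (f : ℕ → ℕ) : Le (glueF n f) f := by
  intro x y h; simp only [glueF, h]

theorem glueF_zero (f : ℕ → ℕ) : glueF 0 f = f := by
  funext x; simp [glueF]

theorem glueF_glueF (n m : ℕ) (f : ℕ → ℕ) : glueF n (glueF m f) = glueF (m + n) f := by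
  funext x; simp only [glueF]; omega

theorem Le.factor {f g : ℕ → ℕ} (hf : Rig f) (hg : Rig g) (h : Le f g) :
    ∃ k, Rig k ∧ f = k ∘ g := by
  choose s hs using hg.2
  have e : f = (fun v => f (s v)) ∘ g := by
    funext x
    exact h _ _ (hs (g x)).symm
  exact ⟨_, Rig.of_comp hg hf e, e⟩

theorem Le.pt {f g : ℕ → ℕ} (hf : Rig f) (hg : Rig g) (h : Le f g) (x : ℕ) : f x ≤ g x := by
  obtain ⟨k, hk, rfl⟩ := h.factor hf hg
  exact hk.le _

theorem Le.glue {f g : ℕ → ℕ} (hf : Rig f) (hg : Rig g) (h : Le f g) (n : ℕ) :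
    Le (glueF n f) (glueF n g) := by
  intro x y e
  have hx := h.pt hf hg x
  have hy := h.pt hf hg y
  simp only [glueF] at e ⊢
  by_cases e2 : g x = g y
  · rw [h x y e2]
  · omega

theorem Le.star {f g : ℕ → ℕ} (h : Le f g) : LeStar f g := ⟨0, by rw [glueF_zero]; exact h⟩

theorem LeStar.tr {f g h : ℕ → ℕ} (hf : Rig f) (hg : Rig g) 
    (h1 : LeStar f g) (h2 : LeStar g h) : LeStar f h := by
  obtain ⟨n, h1⟩ := h1
  obtain ⟨m, h2⟩ := h2
  refine ⟨n + m, ?_⟩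
  rw [← glueF_glueF]
  exact (h1.glue (rig_glueF n hf) hg m).tr h2

theorem pseudo_inter (e : ℕ → ℕ → ℕ) (he : ∀ i, Rig (e i))
    (hc : ∀ i j, LeStar (e i) (e j) ∨ LeStar (e j) (e i)) :
    ∃ W, Rig W ∧ ∀ i, LeStar W (e i) := by
  classical
  let P : (ℕ → ℕ) → Prop := fun Y => ∃ m j, Y = glueF m (e j)
  have hPr : ∀ Y, P Y → Rig Y := by
    rintro Y ⟨m, j, rfl⟩; exact rig_glueF m (he j)
  have step : ∀ n : ℕ, ∀ Y : {Y // P Y}, ∃ Y' : {Y // P Y}, Le Y'.1 Y.1 ∧ LeStar Y'.1 (e n) := by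
    rintro n ⟨Y, m, j, rfl⟩
    rcases hc j n with h | ⟨p, h⟩
    · exact ⟨⟨glueF m (e j), m, j, rfl⟩, Le.rfl' _,
        LeStar.tr (rig_glueF m (he j)) (he j) (glueF_le m (e j)).star h⟩
    · refine ⟨⟨glueF (p + m) (e n), p + m, n, rfl⟩, ?_, (glueF_le _ _).star⟩
      change Le (glueF (p + m) (e n)) (glueF m (e j))
      rw [← glueF_glueF]
      exact h.glue (rig_glueF p (he n)) (he j) m
  choose nx hnx1 hnx2 using step
  let Y : ℕ → {Y // P Y} := fun n => Nat.rec (nx 0 ⟨glueF 0 (e 0), 0, 0, rfl⟩) (fun n y => nx (n + 1) y) n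
  have hYs : ∀ n, Y (n + 1) = nx (n + 1) (Y n) := fun n => rfl
  have hYe : ∀ n, LeStar (Y n).1 (e n) := by
    intro n
    cases n with
    | zero => exact hnx2 _ _
    | succ n => rw [hYs]; exact hnx2 _ _
  have hYr : ∀ n, Rig (Y n).1 := fun n => hPr _ (Y n).2
  have hmono : ∀ n m, n ≤ m → Le (Y m).1 (Y n).1 := by
    intro n m hnm
    induction m, hnm using Nat.le_induction with
    | base => exact Le.rfl' _
    | succ m _ ih =>
      rw [hYs]; exact (hnx1 _ _).tr ih
  have huniq : ∀ x n m, (Y n).1 x = n + 1 → (Y m).1 x = m + 1 → n = m := by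
    intro x n m h1 h2
    rcases lt_trichotomy n m with h | h | h
    · have := (hmono n m h.le).pt (hYr m) (hYr n) x
      omega
    · exact h
    · have := (hmono m n h.le).pt (hYr n) (hYr m) x
      omega
  let w : ℕ → ℕ := fun x => if h : ∃ n, (Y n).1 x = n + 1 then h.choose + 1 else 0
  have hw : ∀ x n, w x = n + 1 ↔ (Y n).1 x = n + 1 := by
    intro x n
    constructor
    · intro h
      by_cases h2 : ∃ n, (Y n).1 x = n + 1
      · have := h2.choose_spec
        simp only [w, dif_pos h2] at h
        have e : h2.choose = n := by omega
        rw [e] at this; exact this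
      · simp [w, dif_neg h2] at h
    · intro h
      have h2 : ∃ n, (Y n).1 x = n + 1 := ⟨n, h⟩
      simp only [w, dif_pos h2]
      rw [huniq x _ n h2.choose_spec h]
  have hinf : (Set.range w).Infinite := by
    refine Set.Infinite.mono ?_ (Set.Ici_infinite 1)
    intro v hv
    have hv : 1 ≤ v := hv
    obtain ⟨n, rfl⟩ : ∃ n, v = n + 1 := ⟨v - 1, by omega⟩
    obtain ⟨x, hx⟩ := (hYr n).2 (n + 1)
    exact ⟨x, (hw x n).2 hx⟩
  obtain ⟨W, hW, hWw⟩ := rigidify w hinf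
  refine ⟨W, hW, fun k => ?_⟩
  refine LeStar.tr hW (hYr k) ?_ (hYe k)
  have hfin : (W '' {x | w x ≤ k}).Finite := by
    have hf : (w '' {x | w x ≤ k}).Finite :=
      (Set.finite_Iic k).subset (by rintro _ ⟨x, hx, rfl⟩; exact hx)
    obtain ⟨φ, hφ⟩ : ∃ φ : ℕ → ℕ, ∀ x, φ (w x) = W x := by
      refine ⟨fun v => if h : ∃ x, w x = v then W h.choose else 0, fun x => ?_⟩
      have h : ∃ y, w y = w x := ⟨x, rfl⟩
      simp only [dif_pos h]
      exact (hWw _ _).2 h.choose_spec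
    refine (hf.image φ).subset ?_
    rintro _ ⟨x, hx, rfl⟩
    exact ⟨w x, ⟨x, hx, rfl⟩, hφ x⟩
  obtain ⟨N, hN⟩ := hfin.bddAbove
  refine ⟨N, ?_⟩
  intro x y hxy
  have key : ∀ x y, (Y k).1 x = (Y k).1 y → k < w x → w x = w y := by
    intro x y hxy h
    obtain ⟨n, hn⟩ : ∃ n, w x = n + 1 := ⟨w x - 1, by omega⟩
    have h1 := (hw x n).1 hn
    have h2 := hmono k n (by omega) x y hxy
    rw [hn]
    exact ((hw y n).2 (by rw [← h2]; exact h1)).symm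
  simp only [glueF]
  by_cases h1 : k < w x
  · rw [(hWw _ _).2 (key x y hxy h1)]
  · by_cases h2 : k < w y
    · rw [(hWw _ _).2 (key y x hxy.symm h2)]
    · have a1 : W x ≤ N := hN ⟨x, not_lt.1 h1, rfl⟩
      have a2 : W y ≤ N := hN ⟨y, not_lt.1 h2, rfl⟩
      omega

theorem pseudo_inter_set {ι : Type*} [Countable ι] (e : ι → ℕ → ℕ) (he : ∀ i, Rig (e i))
    (hc : ∀ i j, LeStar (e i) (e j) ∨ LeStar (e j) (e i)) :
    ∃ W, Rig W ∧ ∀ i, LeStar W (e i) := by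
  rcases isEmpty_or_nonempty ι with h | h
  · exact ⟨id, rig_id, fun i => h.elim i⟩
  · obtain ⟨q, hq⟩ := exists_surjective_nat ι
    obtain ⟨W, h1, h2⟩ := pseudo_inter (fun n => e (q n)) (fun n => he _) (fun i j => hc _ _)
    refine ⟨W, h1, fun i => ?_⟩
    obtain ⟨n, rfl⟩ := hq i
    exact h2 n

def spl (b : Bool) (W : ℕ → ℕ) : ℕ → ℕ := fun x => if b then (W x + 1) / 2 else W x / 2

theorem rig_spl (b : Bool) {W : ℕ → ℕ} (hW : Rig W) : Rig (spl b W) := by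
  have h : Rig (fun i => if b then (i + 1) / 2 else i / 2) := by
    cases b
    · refine ⟨fun i v hv => ⟨2 * v, ?_, ?_⟩, fun v => ⟨2 * v, ?_⟩⟩
      · simp at hv; omega
      · simp
      · simp
    · refine ⟨fun i v hv => ⟨2 * v, ?_, ?_⟩, fun v => ⟨2 * v, ?_⟩⟩
      · simp at hv; omega
      · simp; omega
      · simp; omega
  exact h.comp hW

theorem spl_le (b : Bool) (W : ℕ → ℕ) : Le (spl b W) W := by
  intro x y h; simp only [spl, h]

theorem spl_incompat {W g : ℕ → ℕ} (hW : Rig W) (hg : Rig g)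
    (h1 : Le g (spl true W)) (h2 : Le g (spl false W)) : False := by
  choose s hs using hW.2
  have hstep : ∀ v, g (s (v + 1)) = g (s v) := by
    intro v
    rcases Nat.even_or_odd' v with ⟨c, hc | hc⟩
    · apply h2
      simp only [spl, hs, Bool.false_eq_true, if_false]; omega
    · apply h1
      simp only [spl, hs, if_true]; omega
  have hall : ∀ v, g (s v) = g (s 0) := by
    intro v
    induction v with
    | zero => rfl
    | succ v ih => rw [hstep, ih]
  have hall2 : ∀ x, g x = g (s 0) := by
    intro x
    rw [← hall (W x)]
    apply h1
    simp only [spl, hs]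
  obtain ⟨a, ha⟩ := hg.2 0
  obtain ⟨b, hb⟩ := hg.2 1
  have := hall2 a
  have := hall2 b
  omega

def Kr (f : ℕ → ℕ) (R : ℕ → ℕ → Prop) : Prop := ∀ x y, R x y → f x = f y

theorem Kr.le {f g : ℕ → ℕ} {R : ℕ → ℕ → Prop} (h : Le f g) (hg : Kr g R) : Kr f R :=
  fun x y e => h x y (hg x y e)

abbrev PTask : Type := (ℕ → ℕ → Prop) × ℕ × ℕ × (List ℕ → ℕ)

noncomputable def colT (t : PTask) (h : ℕ → ℕ) (n : ℕ) : Fin (t.2.2.1 + 1) :=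
  Fin.ofNat (t.2.2.1 + 1) (t.2.2.2 (wordOf h n))

theorem local_colT (t : PTask) : LocalCol (colT t) :=
  local_wordOf (fun l => Fin.ofNat (t.2.2.1 + 1) (t.2.2.2 l))

open Classical in
noncomputable def pickW {ι : Type*} (e : ι → ℕ → ℕ) : ℕ → ℕ :=
  if h : ∃ W, Rig W ∧ ∀ i, LeStar W (e i) then h.choose else id

open Classical in
noncomputable def pickZ (R : ℕ → ℕ → Prop) (W : ℕ → ℕ) : ℕ → ℕ :=
  if h : ∃ f, Rig f ∧ Le f W ∧ Kr f R then h.choose else W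

open Classical in
noncomputable def pickH (t : PTask) (V : ℕ → ℕ) : ℕ → ℕ :=
  if h : ∃ G, Rig G ∧ HomF (colT t) t.2.1 (G ∘ V) then h.choose ∘ V else V

theorem pickW_spec {ι : Type*} (e : ι → ℕ → ℕ) (h : ∃ W, Rig W ∧ ∀ i, LeStar W (e i)) :
    Rig (pickW e) ∧ ∀ i, LeStar (pickW e) (e i) := by
  simp only [pickW, dif_pos h]
  exact h.choose_spec

theorem pickZ_spec (R : ℕ → ℕ → Prop) (W : ℕ → ℕ) (hW : Rig W) :
    Rig (pickZ R W) ∧ Le (pickZ R W) W ∧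
      (Kr (pickZ R W) R ∨ ¬ ∃ f, Rig f ∧ Le f W ∧ Kr f R) := by
  by_cases h : ∃ f, Rig f ∧ Le f W ∧ Kr f R
  · simp only [pickZ, dif_pos h]
    exact ⟨h.choose_spec.1, h.choose_spec.2.1, Or.inl h.choose_spec.2.2⟩
  · have e : pickZ R W = W := by simp only [pickZ, dif_neg h]
    rw [e]
    exact ⟨hW, Le.rfl' _, Or.inr h⟩

theorem pickH_spec (t : PTask) (V : ℕ → ℕ) (hV : Rig V) :
    Rig (pickH t V) ∧ Le (pickH t V) V ∧ HomF (colT t) t.2.1 (pickH t V) := by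
  have h := dual_ramsey_below t.2.1 (colT t) (local_colT t) V hV
  simp only [pickH, dif_pos h]
  refine ⟨h.choose_spec.1.comp hV, ?_, h.choose_spec.2⟩
  intro x y e
  simp only [Function.comp, e]

section constr
variable {I : Type} [LinearOrder I] [WellFoundedLT I]

noncomputable def Xf (τ : I → PTask) (h : I → Bool) : I → ℕ → ℕ :=
  (wellFounded_lt (α := I)).fix (C := fun _ => ℕ → ℕ) (fun α prev =>
    pickH (τ α) (spl (h α) (pickZ (τ α).1 (pickW (fun β : Set.Iio α => prev β.1 β.2)))))

theorem Xf_eq (τ : I → PTask) (h : I → Bool) (α : I) : Xf τ h α =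
    pickH (τ α) (spl (h α) (pickZ (τ α).1 (pickW (fun β : Set.Iio α => Xf τ h β.1)))) := by
  rw [Xf, WellFounded.fix_eq]

theorem Xf_main (hcount : ∀ α : I, Countable (Set.Iio α)) (τ : I → PTask) (h : I → Bool) (α : I) :
    Rig (Xf τ h α) ∧ ∀ β < α, LeStar (Xf τ h α) (Xf τ h β) := by
  induction α using WellFoundedLT.induction with
  | ind α ih =>
    have hex : ∃ W, Rig W ∧ ∀ β : Set.Iio α, LeStar W (Xf τ h β.1) := by
      have := hcount α
      refine pseudo_inter_set (fun β : Set.Iio α => Xf τ h β.1) (fun β => (ih β.1 β.2).1) ?_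
      intro i j
      rcases lt_trichotomy i.1 j.1 with e | e | e
      · exact Or.inr ((ih j.1 j.2).2 i.1 e)
      · rw [e]; exact Or.inl (Le.rfl' _).star
      · exact Or.inl ((ih i.1 i.2).2 j.1 e)
    obtain ⟨h1, h2⟩ := pickW_spec _ hex
    obtain ⟨h3, h4, _⟩ := pickZ_spec (τ α).1 _ h1
    obtain ⟨h5, h6, _⟩ := pickH_spec (τ α) _ (rig_spl (h α) h3)
    rw [Xf_eq]
    refine ⟨h5, fun β hβ => ?_⟩
    exact LeStar.tr h5 h1 ((h6.tr (spl_le _ _)).tr h4).star (h2 ⟨β, hβ⟩)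

theorem Xf_pick (hcount : ∀ α : I, Countable (Set.Iio α)) (τ : I → PTask) (h : I → Bool) (α : I) :
    Rig (pickW (fun β : Set.Iio α => Xf τ h β.1)) := by
  refine (pickW_spec _ ?_).1
  have := hcount α
  refine pseudo_inter_set (fun β : Set.Iio α => Xf τ h β.1)
    (fun β => (Xf_main hcount τ h β.1).1) ?_
  intro i j
  rcases lt_trichotomy i.1 j.1 with e | e | e
  · exact Or.inr ((Xf_main hcount τ h j.1).2 i.1 e)
  · rw [e]; exact Or.inl (Le.rfl' _).star
  · exact Or.inl ((Xf_main hcount τ h i.1).2 j.1 e)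

theorem Xf_dec (hcount : ∀ α : I, Countable (Set.Iio α)) (τ : I → PTask) (h : I → Bool) (α : I) :
    Kr (Xf τ h α) (τ α).1 ∨ ¬ ∃ f, Rig f ∧ Le f (Xf τ h α) ∧ Kr f (τ α).1 := by
  have h1 := Xf_pick hcount τ h α
  obtain ⟨h3, h4, h7⟩ := pickZ_spec (τ α).1 _ h1
  obtain ⟨h5, h6, _⟩ := pickH_spec (τ α) _ (rig_spl (h α) h3)
  rw [Xf_eq]
  rcases h7 with h7 | h7
  · exact Or.inl (h7.le (h6.tr (spl_le _ _)))
  · refine Or.inr ?_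
    rintro ⟨f, hf, hf2, hf3⟩
    exact h7 ⟨f, hf, hf2.tr ((h6.tr (spl_le _ _)).tr h4), hf3⟩

theorem Xf_hom (hcount : ∀ α : I, Countable (Set.Iio α)) (τ : I → PTask) (h : I → Bool) (α : I) :
    HomF (colT (τ α)) (τ α).2.1 (Xf τ h α) := by
  have h1 := Xf_pick hcount τ h α
  obtain ⟨h3, h4, h7⟩ := pickZ_spec (τ α).1 _ h1
  rw [Xf_eq]
  exact (pickH_spec (τ α) _ (rig_spl (h α) h3)).2.2

theorem Xf_split (hcount : ∀ α : I, Countable (Set.Iio α)) (τ : I → PTask) (h h' : I → Bool) (α : I)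
    (heq : ∀ β < α, Xf τ h β = Xf τ h' β) (ha : h α = true) (ha' : h' α = false)
    (g : ℕ → ℕ) (hg : Rig g) (g1 : Le g (Xf τ h α)) (g2 : Le g (Xf τ h' α)) : False := by
  have h1 := Xf_pick hcount τ h α
  have e : (fun β : Set.Iio α => Xf τ h β.1) = (fun β : Set.Iio α => Xf τ h' β.1) := by
    funext β
    exact heq β.1 β.2
  obtain ⟨h3, h4, h7⟩ := pickZ_spec (τ α).1 _ h1
  have a1 := (pickH_spec (τ α) _ (rig_spl (h α) h3)).2.1
  have a2 := (pickH_spec (τ α) _ (rig_spl (h' α) h3)).2.1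
  rw [Xf_eq] at g1 g2
  rw [← e] at g2
  have b1 := g1.tr a1
  have b2 := g2.tr a2
  rw [ha] at b1
  rw [ha'] at b2
  exact spl_incompat h3 hg b1 b2

end constr

theorem IsPartition.cov {X : Set (Set ℕ)} (hX : IsPartition X) (x : ℕ) : ∃ b ∈ X, x ∈ b := by
  have : x ∈ ⋃₀ X := by rw [hX.2.2]; trivial
  exact this

theorem IsPartition.eqb {X : Set (Set ℕ)} (hX : IsPartition X) {b d : Set ℕ} (hb : b ∈ X)
    (hd : d ∈ X) {x : ℕ} (h1 : x ∈ b) (h2 : x ∈ d) : b = d := by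
  by_contra hcon
  exact Set.disjoint_left.1 (hX.2.1 b hb d hd hcon) h1 h2

theorem Coarser.same {X Y : Set (Set ℕ)} (hX : IsPartition X) (hY : IsPartition Y)
    (h : Coarser X Y) {x y : ℕ} (hs : SameBlock Y x y) : SameBlock X x y := by
  obtain ⟨b, hb, hxb⟩ := hX.cov x
  obtain ⟨S, hS, hbS⟩ := h b hb
  have hx2 := hxb
  rw [hbS] at hx2
  obtain ⟨d, hd, hxd⟩ := hx2
  obtain ⟨c, hc, h1, h2⟩ := hs
  have e := hY.eqb hc (hS hd) h1 hxd
  refine ⟨b, hb, hxb, ?_⟩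
  rw [hbS]
  exact ⟨d, hd, e ▸ h2⟩

theorem coarser_of_same {X Y : Set (Set ℕ)} (hX : IsPartition X) (hY : IsPartition Y)
    (h : ∀ x y, SameBlock Y x y → SameBlock X x y) : Coarser X Y := by
  intro b hb
  refine ⟨{d | d ∈ Y ∧ d ⊆ b}, fun d hd => hd.1, ?_⟩
  ext x
  constructor
  · intro hx
    obtain ⟨d, hd, hxd⟩ := hY.cov x
    refine ⟨d, ⟨hd, ?_⟩, hxd⟩
    intro y hy
    obtain ⟨c, hc, h1, h2⟩ := h x y ⟨d, hd, hxd, hy⟩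
    rw [hX.eqb hb hc hx h1]; exact h2
  · rintro ⟨d, hd, hxd⟩
    exact hd.2 hxd

theorem isPartition_eqvGen (R : ℕ → ℕ → Prop) :
    IsPartition {b | ∃ n, b = {m | Relation.EqvGen R n m}} := by
  refine ⟨?_, ?_, ?_⟩
  · rintro b ⟨n, rfl⟩
    exact ⟨n, Relation.EqvGen.refl n⟩
  · rintro b ⟨n, rfl⟩ c ⟨m, rfl⟩ hne
    rw [Set.disjoint_left]
    intro x hx hx'
    apply hne
    have hx : Relation.EqvGen R n x := hx
    have hx' : Relation.EqvGen R m x := hx'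
    ext y
    constructor
    · intro hy
      exact (hx'.trans _ _ _ (hx.symm _ _)).trans _ _ _ hy
    · intro hy
      exact (hx.trans _ _ _ (hx'.symm _ _)).trans _ _ _ hy
  · ext x
    simp only [Set.mem_sUnion, Set.mem_univ, iff_true]
    exact ⟨_, ⟨x, rfl⟩, Relation.EqvGen.refl x⟩

theorem eqvGen_kr {R : ℕ → ℕ → Prop} {g : ℕ → ℕ} (h : Kr g R) : Kr g (Relation.EqvGen R) := by
  intro x y hxy
  induction hxy with
  | rel x y h1 => exact h _ _ h1
  | refl x => rfl
  | symm x y _ ih => exact ih.symm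
  | trans x y z _ _ ih1 ih2 => exact ih1.trans ih2

section filt
variable {I : Type} [LinearOrder I]

def UF (X : I → ℕ → ℕ) : Set (Set (Set ℕ)) :=
  {Y | IsPartition Y ∧ ∃ α n, Kr (glueF n (X α)) (SameBlock Y)}

theorem glueF_mono {n m : ℕ} (h : n ≤ m) (f : ℕ → ℕ) : Le (glueF m f) (glueF n f) := by
  intro x y e
  simp only [glueF] at *
  omega

theorem UF_dir (X : I → ℕ → ℕ) (hr : ∀ α, Rig (X α)) (hlt : ∀ α, ∀ β < α, LeStar (X α) (X β))
    (α β : I) (n m : ℕ) : ∃ γ N, Le (glueF N (X γ)) (glueF n (X α)) ∧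
      Le (glueF N (X γ)) (glueF m (X β)) := by
  have hle : ∀ α β, β ≤ α → LeStar (X α) (X β) := by
    intro α β h
    rcases h.eq_or_lt with e | e
    · rw [e]; exact (Le.rfl' _).star
    · exact hlt _ _ e
  obtain ⟨p, hp⟩ := hle (max α β) α (le_max_left _ _)
  obtain ⟨q, hq⟩ := hle (max α β) β (le_max_right _ _)
  have hp' := hp.glue (rig_glueF p (hr _)) (hr α) n
  have hq' := hq.glue (rig_glueF q (hr _)) (hr β) m
  rw [glueF_glueF] at hp' hq'
  exact ⟨max α β, (p + n) + (q + m), (glueF_mono (by omega) _).tr hp',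
    (glueF_mono (by omega) _).tr hq'⟩

theorem mem_UF_glue (X : I → ℕ → ℕ) (hr : ∀ α, Rig (X α)) (α : I) (n : ℕ) :
    partOf (glueF n (X α)) ∈ UF X :=
  ⟨isPartition_partOf _ (rig_glueF n (hr α)), α, n,
    fun x y h => (sameBlock_partOf _ x y).1 h⟩

theorem UF_compat (X : I → ℕ → ℕ) (hr : ∀ α, Rig (X α)) (hlt : ∀ α, ∀ β < α, LeStar (X α) (X β))
    {Y Z : Set (Set ℕ)} (hY : Y ∈ UF X) (hZ : Z ∈ UF X) :
    ∃ γ N, Kr (glueF N (X γ)) (SameBlock Y) ∧ Kr (glueF N (X γ)) (SameBlock Z) := by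
  obtain ⟨_, α, n, h1⟩ := hY
  obtain ⟨_, β, m, h2⟩ := hZ
  obtain ⟨γ, N, h3, h4⟩ := UF_dir X hr hlt α β n m
  exact ⟨γ, N, h1.le h3, h2.le h4⟩

theorem UF_filter (X : I → ℕ → ℕ) (hr : ∀ α, Rig (X α)) (hlt : ∀ α, ∀ β < α, LeStar (X α) (X β)) :
    IsPartitionFilter (UF X) := by
  refine ⟨fun Y hY => hY.1, ?_, ?_, ?_⟩
  · rintro ⟨_, α, n, h⟩
    have hg := rig_glueF n (hr α)
    obtain ⟨a, ha⟩ := hg.2 0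
    obtain ⟨b, hb⟩ := hg.2 1
    have := h a b ⟨Set.univ, rfl, trivial, trivial⟩
    omega
  · intro Y hY Z hZ
    obtain ⟨γ, N, h1, h2⟩ := UF_compat X hr hlt hY hZ
    refine ⟨isPartition_eqvGen _, γ, N, ?_⟩
    rintro x y ⟨b, ⟨n, rfl⟩, hx, hy⟩
    have hk : Kr (glueF N (X γ)) (fun a c => SameBlock Y a c ∨ SameBlock Z a c) := by
      rintro a c (h | h)
      · exact h1 a c h
      · exact h2 a c h
    have e1 := eqvGen_kr hk n x hx
    have e2 := eqvGen_kr hk n y hy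
    exact e1.symm.trans e2
  · rintro Y ⟨hY, α, n, h⟩ Z hZ hc
    exact ⟨hZ, α, n, fun x y hs => h x y (hc.same hY hZ hs)⟩

theorem UF_inf (X : I → ℕ → ℕ) (hr : ∀ α, Rig (X α)) (Y : Set (Set ℕ)) (hY : Y ∈ UF X) :
    Y.Infinite := by
  classical
  obtain ⟨hp, α, n, h⟩ := hY
  have hg := rig_glueF n (hr α)
  intro hfin
  let φ : Set ℕ → ℕ := fun b => if hb : b.Nonempty then glueF n (X α) hb.choose else 0
  have hsub : Set.range (glueF n (X α)) ⊆ φ '' Y := by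
    rintro _ ⟨x, rfl⟩
    obtain ⟨b, hb, hx⟩ := hp.cov x
    refine ⟨b, hb, ?_⟩
    have hne : b.Nonempty := ⟨x, hx⟩
    simp only [φ, dif_pos hne]
    exact h _ _ ⟨b, hb, hne.choose_spec, hx⟩
  have := (hfin.image φ).subset hsub
  rw [hg.2.range_eq] at this
  exact Set.infinite_univ this

theorem UF_ultra (X : I → ℕ → ℕ) (hr : ∀ α, Rig (X α)) (hlt : ∀ α, ∀ β < α, LeStar (X α) (X β))
    (hdec : ∀ R : ℕ → ℕ → Prop, ∃ α, Kr (X α) R ∨ ¬ ∃ f, Rig f ∧ Le f (X α) ∧ Kr f R) :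
    IsPartitionUltrafilter (UF X) := by
  refine ⟨UF_filter X hr hlt, fun F hF hUF => Set.Subset.antisymm hUF ?_⟩
  intro Z hZ
  obtain ⟨α, h | h⟩ := hdec (SameBlock Z)
  · exact ⟨hF.1 Z hZ, α, 0, by rw [glueF_zero]; exact h⟩
  exfalso
  let R : ℕ → ℕ → Prop := fun a c => X α a = X α c ∨ SameBlock Z a c
  let st : Setoid ℕ := Relation.EqvGen.setoid R
  let w : ℕ → Quotient st := fun x => Quotient.mk st x
  have hw : ∀ x y, w x = w y ↔ Relation.EqvGen R x y := fun x y => Quotient.eq (r := st)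
  by_cases hinf : (Set.range w).Infinite
  · obtain ⟨f, hf, hfw⟩ := rigidify w hinf
    refine h ⟨f, hf, ?_, ?_⟩
    · intro x y e
      rw [hfw, hw]
      exact Relation.EqvGen.rel _ _ (Or.inl e)
    · intro x y e
      rw [hfw, hw]
      exact Relation.EqvGen.rel _ _ (Or.inr e)
  · rw [Set.not_infinite] at hinf
    obtain ⟨N, hN⟩ := (hinf.image Quotient.out).bddAbove
    have hmem := hUF (mem_UF_glue X hr α N)
    have hone := hF.2.2.1 _ hmem Z hZ
    have e : pMeet (partOf (glueF N (X α))) Z = OneBlock := by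
      have hR : ∀ x, Relation.EqvGen
          (fun a c => SameBlock (partOf (glueF N (X α))) a c ∨ SameBlock Z a c) 0 x := by
        intro x
        have h1 : (w x).out ≤ N := hN ⟨w x, ⟨x, rfl⟩, rfl⟩
        have h2 : Relation.EqvGen R (w x).out x := by
          rw [← hw]; exact Quotient.out_eq (w x)
        refine Relation.EqvGen.trans _ (w x).out _ (Relation.EqvGen.rel _ _ (Or.inl ?_)) ?_
        · rw [sameBlock_partOf]
          have := (hr α).le (w x).out
          have := (hr α).le 0
          simp only [glueF]; omega
        · refine Relation.EqvGen.mono ?_ _ _ h2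
          rintro a c (h | h)
          · left
            rw [sameBlock_partOf]
            simp only [glueF, h]
          · exact Or.inr h
      ext b
      constructor
      · rintro ⟨n, rfl⟩
        have : {m | Relation.EqvGen
          (fun a c => SameBlock (partOf (glueF N (X α))) a c ∨ SameBlock Z a c) n m} = Set.univ := by
          ext m
          simp only [Set.mem_univ, iff_true]
          exact ((hR n).symm _ _).trans _ _ _ (hR m)
        rw [this]; exact rfl
      · intro hb
        have hb : b = Set.univ := hb
        refine ⟨0, ?_⟩
        rw [hb]
        ext m
        simp only [Set.mem_univ, true_iff]
        exact hR m
    rw [e] at hone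
    exact hF.2.1 hone

theorem UF_seg (X : I → ℕ → ℕ) (τ : I → PTask) (hτ : Function.Surjective τ)
    (hr : ∀ α, Rig (X α)) (hlt : ∀ α, ∀ β < α, LeStar (X α) (X β))
    (hdec : ∀ α, Kr (X α) (τ α).1 ∨ ¬ ∃ f, Rig f ∧ Le f (X α) ∧ Kr f (τ α).1)
    (hhom : ∀ α, HomF (colT (τ α)) (τ α).2.1 (X α)) :
    SegColProp (UF X) := by
  intro k r π Z hZ
  obtain ⟨α, hα⟩ := hτ (SameBlock Z, k, r, fun l => (π (segL l) l.length).val)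
  have hd := hdec α
  have hh := hhom α
  rw [hα] at hd hh
  have hK : Kr (X α) (SameBlock Z) := by
    rcases hd with h | h
    · exact h
    · exfalso
      obtain ⟨_, β, n, h1⟩ := hZ
      obtain ⟨γ, N, h3, h4⟩ := UF_dir X hr hlt α β 0 n
      rw [glueF_zero] at h3
      exact h ⟨_, rig_glueF N (hr γ), h3, h1.le h4⟩
  have hm := mem_UF_glue X hr α 0
  rw [glueF_zero] at hm
  refine ⟨partOf (X α), hm, ?_, ?_⟩
  · exact coarser_of_same hm.1 hZ.1 (fun x y h => (sameBlock_partOf _ x y).2 (hK x y h))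
  · apply seg_translate k π (X α) (hr α)
    have e : (fun h n => π (segL (wordOf h n)) (wordOf h n).length)
        = colT (SameBlock Z, k, r, fun l => (π (segL l) l.length).val) := by
      funext h n
      simp [colT]
    rw [e]
    exact hh

theorem UF_ramseyan (X : I → ℕ → ℕ) (τ : I → PTask) (hτ : Function.Surjective τ)
    (hr : ∀ α, Rig (X α)) (hlt : ∀ α, ∀ β < α, LeStar (X α) (X β))
    (hdec : ∀ α, Kr (X α) (τ α).1 ∨ ¬ ∃ f, Rig f ∧ Le f (X α) ∧ Kr f (τ α).1)
    (hhom : ∀ α, HomF (colT (τ α)) (τ α).2.1 (X α)) :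
    RamseyanUltrafilter (UF X) := by
  refine ⟨UF_ultra X hr hlt ?_, UF_inf X hr, UF_seg X τ hτ hr hlt hdec hhom⟩
  intro R
  obtain ⟨α, hα⟩ := hτ (R, 0, 0, fun _ => 0)
  refine ⟨α, ?_⟩
  have := hdec α
  rw [hα] at this
  exact this

theorem UF_inj [WellFoundedLT I] (hcount : ∀ α : I, Countable (Set.Iio α)) (τ : I → PTask) :
    Function.Injective (fun h : I → Bool => UF (Xf τ h)) := by
  intro h h' e
  simp only at e
  have hr := fun h α => (Xf_main hcount τ h α).1
  have hlt := fun h α => (Xf_main hcount τ h α).2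
  funext α
  induction α using WellFoundedLT.induction with
  | ind α ih =>
    have heq : ∀ β < α, Xf τ h β = Xf τ h' β := by
      intro β
      induction β using WellFoundedLT.induction with
      | ind β ih2 =>
        intro hβ
        rw [Xf_eq, Xf_eq, ih β hβ]
        have : (fun δ : Set.Iio β => Xf τ h δ.1) = (fun δ : Set.Iio β => Xf τ h' δ.1) := by
          funext δ
          exact ih2 δ.1 δ.2 (lt_trans δ.2 hβ)
        rw [this]
    by_contra hne
    have m1 := mem_UF_glue (Xf τ h) (hr h) α 0
    have m2 := mem_UF_glue (Xf τ h') (hr h') α 0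
    rw [← e] at m2
    obtain ⟨γ, N, h1, h2⟩ := UF_compat (Xf τ h) (hr h) (hlt h) m1 m2
    have g1 : Le (glueF N (Xf τ h γ)) (Xf τ h α) := fun x y hxy => h1 x y (by
      rw [sameBlock_partOf, glueF_zero]; exact hxy)
    have g2 : Le (glueF N (Xf τ h γ)) (Xf τ h' α) := fun x y hxy => h2 x y (by
      rw [sameBlock_partOf, glueF_zero]; exact hxy)
    have hg := rig_glueF N (hr h γ)
    cases ha : h α <;> cases ha' : h' α
    · exact hne (ha.trans ha'.symm)
    · exact Xf_split hcount τ h' h α (fun β hβ => (heq β hβ).symm) ha' ha _ hg g2 g1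
    · exact Xf_split hcount τ h h' α heq ha ha' _ hg g1 g2
    · exact hne (ha.trans ha'.symm)

end filt

theorem exists_indep {J A : Type} (E : J → J → Prop) (hsymm : ∀ a b, E a b → E b a)
    (κ : Cardinal) (hκ : Cardinal.aleph0 ≤ κ) (hA : Cardinal.mk A ≤ κ)
    (φ : J → A → J) (hφ : ∀ a b, E a b → ∃ g, φ a g = b) (hJ : κ < Cardinal.mk J) :
    ∃ M : Set J, Cardinal.mk M = Cardinal.mk J ∧ ∀ a ∈ M, ∀ b ∈ M, a ≠ b → ¬ E a b := by
  classical
  obtain ⟨M, hM⟩ := zorn_subset {M : Set J | ∀ a ∈ M, ∀ b ∈ M, a ≠ b → ¬ E a b} (by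
    intro c hc hch
    refine ⟨⋃₀ c, ?_, fun s hs => Set.subset_sUnion_of_mem hs⟩
    rintro a ⟨s, hs, ha⟩ b ⟨t, ht, hb⟩ hab
    rcases hch.total hs ht with h | h
    · exact hc ht a (h ha) b hb hab
    · exact hc hs a ha b (h hb) hab)
  have hind : ∀ a ∈ M, ∀ b ∈ M, a ≠ b → ¬ E a b := hM.1
  refine ⟨M, ?_, hind⟩
  have hcov : ∀ j, ∃ m : M, m.1 = j ∨ E m.1 j := by
    intro j
    by_cases hj : j ∈ M
    · exact ⟨⟨j, hj⟩, Or.inl rfl⟩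
    by_contra hcon
    push Not at hcon
    have hins : insert j M ∈ {M : Set J | ∀ a ∈ M, ∀ b ∈ M, a ≠ b → ¬ E a b} := by
      rintro a (rfl | ha) b (rfl | hb) hab
      · exact absurd rfl hab
      · exact fun h => (hcon ⟨b, hb⟩).2 (hsymm _ _ h)
      · exact (hcon ⟨a, ha⟩).2
      · exact hind a ha b hb hab
    exact hj (hM.2 hins (Set.subset_insert _ _) (Set.mem_insert _ _))
  choose p hp using hcov
  have hfib : ∀ m : M, Cardinal.mk (p ⁻¹' {m}) ≤ κ := by
    intro m
    have hsub : p ⁻¹' {m} ⊆ insert m.1 (Set.range (φ m.1)) := by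
      intro j hj
      have hj : p j = m := hj
      rcases hp j with h | h
      · left; rw [← hj]; exact h.symm
      · right; rw [hj] at h; exact hφ _ _ h
    refine (Cardinal.mk_le_mk_of_subset hsub).trans (Cardinal.mk_insert_le.trans ?_)
    exact Cardinal.add_le_of_le hκ (Cardinal.mk_range_le.trans hA)
      (Cardinal.one_le_aleph0.trans hκ)
  have hle := Cardinal.mk_le_mk_mul_of_mk_preimage_le p hfib
  apply le_antisymm (Cardinal.mk_set_le M)
  by_contra hcon
  push Not at hcon
  exact absurd hle (not_le.2 (Cardinal.mul_lt_of_lt (hκ.trans hJ.le) hcon hJ))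

theorem mk_PTask : Cardinal.mk PTask = Cardinal.continuum := by
  have h1 : Cardinal.mk (ℕ → ℕ → Prop) = Cardinal.continuum := by
    simp
  have h2 : Cardinal.mk (List ℕ → ℕ) = Cardinal.continuum := by
    simp
  simp [PTask, h1, h2]

theorem ch_zero (h : Cardinal.continuum.{u} = Cardinal.aleph.{u} 1) :
    Cardinal.continuum.{0} = Cardinal.aleph.{0} 1 := by
  apply Cardinal.lift_injective.{u, 0}
  rw [Cardinal.lift_continuum, Cardinal.lift_aleph, Ordinal.lift_one]
  exact h

/-- CH implies the existence of `2 ^ 𝔠` pairwise non-equivalent Ramseyan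
ultrafilters. -/
theorem stmt10 (hCH : Cardinal.continuum = Cardinal.aleph 1) :
    ∃ 𝒰 : Set (Set (Set (Set ℕ))),
      Cardinal.mk 𝒰 = 2 ^ Cardinal.continuum ∧
      (∀ U ∈ 𝒰, RamseyanUltrafilter U) ∧
      (∀ U ∈ 𝒰, ∀ V ∈ 𝒰, U ≠ V → ¬ EquivPF U V) := by
  classical
  obtain ⟨I, iL, iW, hI, hcount⟩ : ∃ (I : Type) (_ : LinearOrder I) (_ : WellFoundedLT I),
      Cardinal.mk I = Cardinal.continuum ∧ ∀ α : I, Countable (Set.Iio α) := by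
    refine ⟨(Cardinal.aleph 1).ord.ToType, inferInstance, inferInstance, ?_, ?_⟩
    · rw [ch_zero hCH]; simp
    · intro α
      have h1 : Cardinal.mk (Set.Iio α) < Cardinal.aleph 1 := by
        have := Cardinal.mk_Iio_lt α (by simp)
        simpa using this
      have h2 : Cardinal.mk (Set.Iio α) < Order.succ Cardinal.aleph0 := by
        rw [Cardinal.succ_aleph0]; exact h1
      exact Cardinal.mk_le_aleph0_iff.1 (Order.lt_succ_iff.1 h2)
  obtain ⟨eq⟩ := Cardinal.eq.1 (hI.trans mk_PTask.symm)
  let U : (I → Bool) → Set (Set (Set ℕ)) := fun h => UF (Xf eq h)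
  have hinj : Function.Injective U := UF_inj hcount eq
  have hram : ∀ h, RamseyanUltrafilter (U h) := fun h =>
    UF_ramseyan (Xf eq h) eq eq.surjective (fun α => (Xf_main hcount eq h α).1)
      (fun α => (Xf_main hcount eq h α).2) (Xf_dec hcount eq h) (Xf_hom hcount eq h)
  have hJ : Cardinal.mk (I → Bool) = 2 ^ Cardinal.continuum := by
    simp [hI]
  obtain ⟨M, hM, hM2⟩ := exists_indep (fun h h' => EquivPF (U h) (U h')) 
    (fun a b h => ⟨h.2, h.1⟩) Cardinal.continuum Cardinal.aleph0_le_continuum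
    (A := ℕ → ℕ) (by simp)
    (fun h g => if hx : ∃ h', imageFilter g (U h) = U h' then hx.choose else h)
    (by
      rintro a b ⟨_, g, _, hg⟩
      have hx : ∃ h', imageFilter g (U a) = U h' := ⟨b, hg⟩
      refine ⟨g, ?_⟩
      simp only [dif_pos hx]
      exact hinj (hx.choose_spec.symm.trans hg))
    (by rw [hJ]; exact Cardinal.cantor _)
  refine ⟨U '' M, ?_, ?_, ?_⟩
  · rw [Cardinal.mk_image_eq hinj, hM, hJ]
  · rintro _ ⟨h, _, rfl⟩
    exact hram h
  · rintro _ ⟨h, hh, rfl⟩ _ ⟨h', hh', rfl⟩ hne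
    exact hM2 h hh h' hh' (fun e => hne (by rw [e]))
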